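/- arXiv:2106.13317 — 3 statements merged into one kernel-verified Lean document; each statement's English description precedes it below -/
import Mathlib

section
/- Let n ∈ ℕ with n ≥ 2, ℓ ∈ ℕ₀, α ∈ ℝ, R ∈ (0,∞), and let q : (0,R) → ℝ be measurable and locally integrable. Consider on (0,R) the differential expression τ_{n,ℓ,α} = −(d/dr) r^α (d/dr) + [ (n−1)(n−3+2α)/4 + ℓ(ℓ+n−2) ]·r^(α−2) + q(r). If there exists r₁ ∈ (0,R) such that q(r) ≥ −[ n(n−4+2α)/4 + ℓ(ℓ+n−2) ]·r^(α−2) for a.e. r ∈ (0,r₁), then τ_{n,ℓ,α} is nonoscillatory at r = 0 and in the limit point case at r = 0. -/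
noncomputable section

open MeasureTheory Set
open scoped ENNReal NNReal

/-- `(u, v)` is a (complex-valued) solution of `τ u = z u` on `(0, R)`, where
`τ = -(d/dx) x^α (d/dx) + Q(x)` and `v` plays the role of the quasi-derivative `x^α u'`. -/
def IsSolutionC (R : ℝ) (α : ℝ) (Q : ℝ → ℝ) (z : ℂ) (u v : ℝ → ℂ) : Prop :=
  ∀ x ∈ Ioo (0 : ℝ) R, ∀ x₀ ∈ Ioo (0 : ℝ) R,
    (u x = u x₀ + ∫ t in x₀..x, ((t ^ (-α) : ℝ) : ℂ) * v t) ∧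
    (v x = v x₀ + ∫ t in x₀..x, ((Q t : ℂ) - z) * u t)

/-- `(u, v)` is a real-valued solution of `τ u = λ u` on `(0, R)`. -/
def IsSolutionR (R : ℝ) (α : ℝ) (Q : ℝ → ℝ) (lam : ℝ) (u v : ℝ → ℝ) : Prop :=
  ∀ x ∈ Ioo (0 : ℝ) R, ∀ x₀ ∈ Ioo (0 : ℝ) R,
    (u x = u x₀ + ∫ t in x₀..x, (t ^ (-α)) * v t) ∧
    (v x = v x₀ + ∫ t in x₀..x, (Q t - lam) * u t)

/-- `τ` is in the limit point case at `x = 0`. -/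
def LimitPointAtZero (R : ℝ) (α : ℝ) (Q : ℝ → ℝ) : Prop :=
  ∀ z : ℂ, ∃ u v : ℝ → ℂ, IsSolutionC R α Q z u v ∧
    ∃ c ∈ Ioo (0 : ℝ) R, (∫⁻ x in Ioo (0 : ℝ) c, (‖u x‖₊ : ℝ≥0∞) ^ 2) = ⊤

/-- `τ` is in the limit circle case at `x = 0`. -/
def LimitCircleAtZero (R : ℝ) (α : ℝ) (Q : ℝ → ℝ) : Prop :=
  ∀ z : ℂ, ∀ u v : ℝ → ℂ, IsSolutionC R α Q z u v →
    ∃ c ∈ Ioo (0 : ℝ) R, (∫⁻ x in Ioo (0 : ℝ) c, (‖u x‖₊ : ℝ≥0∞) ^ 2) < ⊤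

/-- `τ` is nonoscillatory at `x = 0`. -/
def NonoscillatoryAtZero (R : ℝ) (α : ℝ) (Q : ℝ → ℝ) : Prop :=
  ∃ u v : ℝ → ℝ, IsSolutionR R α Q 0 u v ∧ (¬ ∀ x ∈ Ioo (0 : ℝ) R, u x = 0 ∧ v x = 0) ∧
    ∃ c ∈ Ioo (0 : ℝ) R, {x ∈ Ioo (0 : ℝ) c | u x = 0}.Finite

/-- Iterated logarithms: `iterLog 1 x = ln (1/x)`, `iterLog (j+1) x = ln (iterLog j x)`. -/
def iterLog : ℕ → ℝ → ℝ
  | 0, x => 1 / x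
  | j + 1, x => Real.log (iterLog j x)

section Primitives

variable {𝕜 : Type*} [RCLike 𝕜]

/-- `F` is a (locally absolutely continuous) primitive of the locally integrable function `f` on
the open interval `(a, b)`. -/
def IsPrimitiveOn (a b : ℝ) (F f : ℝ → 𝕜) : Prop :=
  ∀ x ∈ Ioo a b, ∀ y ∈ Ioo a b,
    IntervalIntegrable f volume x y ∧ F y = F x + ∫ t in x..y, f t

lemma absolutelyContinuousOnInterval_primitive {E : Type*} [NormedAddCommGroup E]
    [NormedSpace ℝ E] {f : ℝ → E} {a b : ℝ} (h : IntervalIntegrable f volume a b) :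
    AbsolutelyContinuousOnInterval (fun x => ∫ t in a..x, f t) a b := by
  have hn := h.norm.absolutelyContinuousOnInterval_intervalIntegral (c := a) (by simp)
  rw [absolutelyContinuousOnInterval_iff] at hn ⊢
  intro ε hε
  obtain ⟨δ, hδ, H⟩ := hn ε hε
  refine ⟨δ, hδ, fun E hE hlt => lt_of_le_of_lt ?_ (H E hE hlt)⟩
  refine Finset.sum_le_sum fun i hi => ?_
  obtain ⟨h1, h2⟩ := hE.1 i hi
  have sub : ∀ {c d : ℝ}, c ∈ uIcc a b → d ∈ uIcc a b → IntervalIntegrable f volume c d :=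
    fun hc hd => h.mono_set (uIcc_subset_uIcc hc hd)
  have ha : a ∈ uIcc a b := by simp
  rw [dist_eq_norm, dist_eq_norm,
    intervalIntegral.integral_interval_sub_left (sub ha h1) (sub ha h2),
    intervalIntegral.integral_interval_sub_left (sub ha h1).norm (sub ha h2).norm]
  exact intervalIntegral.norm_integral_le_abs_integral_norm

/-- The product rule for primitives of integrable functions. -/
lemma integral_product_rule {f g : ℝ → 𝕜} {a b : ℝ} (hf : IntervalIntegrable f volume a b)
    (hg : IntervalIntegrable g volume a b) (A B : 𝕜) :
    (A + ∫ t in a..b, f t) * (B + ∫ t in a..b, g t) = A * B +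
      ∫ s in a..b, (f s * (B + ∫ t in a..s, g t) + (A + ∫ t in a..s, f t) * g s) := by
  have hFc : ContinuousOn (fun s => A + ∫ t in a..s, f t) (uIcc a b) :=
    continuousOn_const.add (intervalIntegral.continuousOn_primitive_interval' hf (by simp))
  have hGc : ContinuousOn (fun s => B + ∫ t in a..s, g t) (uIcc a b) :=
    continuousOn_const.add (intervalIntegral.continuousOn_primitive_interval' hg (by simp))
  have hi : IntervalIntegrable
      (fun s => f s * (B + ∫ t in a..s, g t) + (A + ∫ t in a..s, f t) * g s) volume a b :=
    (hf.mul_continuousOn hGc).add (hg.continuousOn_mul hFc)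
  have hconst : ∀ C : 𝕜, AbsolutelyContinuousOnInterval (fun _ : ℝ => C) a b := fun C =>
    (LipschitzOnWith.absolutelyContinuousOnInterval (K := 0)
      (LipschitzWith.const C).lipschitzOnWith)
  have hac := ((((hconst A).fun_add (absolutelyContinuousOnInterval_primitive hf)).fun_smul
    ((hconst B).fun_add (absolutelyContinuousOnInterval_primitive hg)))).fun_sub
    (absolutelyContinuousOnInterval_primitive hi)
  obtain ⟨C, hC⟩ := hac.const_of_ae_hasDerivAt_zero (by
    filter_upwards [hf.ae_hasDerivAt_integral, hg.ae_hasDerivAt_integral,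
      hi.ae_hasDerivAt_integral] with s h1 h2 h3 hs
    have h1 := (h1 hs a (by simp)).const_add A
    have h2 := (h2 hs a (by simp)).const_add B
    have h3 := h3 hs a (by simp)
    have := (h1.mul h2).sub h3
    simp only [sub_self] at this
    exact this)
  have e1 := hC a (by simp)
  have e2 := hC b (by simp)
  simp only [intervalIntegral.integral_same, add_zero, sub_zero, smul_eq_mul] at e1 e2
  rw [e1, ← e2]; ring

namespace IsPrimitiveOn

variable {a b : ℝ} {F G f g : ℝ → 𝕜}

lemma continuousOn (hF : IsPrimitiveOn a b F f) : ContinuousOn F (Ioo a b) := by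
  intro x hx
  obtain ⟨c, hac, hcx⟩ := exists_between hx.1
  obtain ⟨d, hxd, hdb⟩ := exists_between hx.2
  have hc : c ∈ Ioo a b := ⟨hac, hcx.trans hx.2⟩
  have hd : d ∈ Ioo a b := ⟨hx.1.trans hxd, hdb⟩
  have hcont : ContinuousOn F (uIcc c d) := by
    refine ((continuousOn_const (c := F c)).add
      (intervalIntegral.continuousOn_primitive_interval' (hF c hc d hd).1 left_mem_uIcc)).congr ?_
    intro y hy
    rw [uIcc_of_le (hcx.trans hxd).le] at hy
    exact (hF c hc y ⟨hac.trans_le hy.1, hy.2.trans_lt hdb⟩).2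
  rw [uIcc_of_le (hcx.trans hxd).le] at hcont
  exact (hcont.continuousAt (Icc_mem_nhds hcx hxd)).continuousWithinAt

lemma congr (hF : IsPrimitiveOn a b F f) (h : EqOn f g (Ioo a b)) : IsPrimitiveOn a b F g := by
  intro x hx y hy
  have hsub : uIcc x y ⊆ Ioo a b := OrdConnected.uIcc_subset inferInstance hx hy
  refine ⟨(hF x hx y hy).1.congr fun t ht => h (hsub (uIoc_subset_uIcc ht)), ?_⟩
  rw [(hF x hx y hy).2, intervalIntegral.integral_congr fun t ht => h (hsub ht)]

lemma mul (hF : IsPrimitiveOn a b F f) (hG : IsPrimitiveOn a b G g) :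
    IsPrimitiveOn a b (fun x => F x * G x) (fun x => f x * G x + F x * g x) := by
  intro x hx y hy
  have hsub : uIcc x y ⊆ Ioo a b := OrdConnected.uIcc_subset inferInstance hx hy
  obtain ⟨hf, hFy⟩ := hF x hx y hy
  obtain ⟨hg, hGy⟩ := hG x hx y hy
  refine ⟨(hf.mul_continuousOn (hG.continuousOn.mono hsub)).add
    (hg.continuousOn_mul (hF.continuousOn.mono hsub)), ?_⟩
  beta_reduce
  rw [hFy, hGy, integral_product_rule hf hg]
  congr 1
  refine intervalIntegral.integral_congr fun s hs => ?_
  rw [(hF x hx s (hsub hs)).2, (hG x hx s (hsub hs)).2]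

lemma add (hF : IsPrimitiveOn a b F f) (hG : IsPrimitiveOn a b G g) :
    IsPrimitiveOn a b (fun x => F x + G x) (fun x => f x + g x) := by
  intro x hx y hy
  obtain ⟨hf, hFy⟩ := hF x hx y hy
  obtain ⟨hg, hGy⟩ := hG x hx y hy
  refine ⟨hf.add hg, ?_⟩
  beta_reduce
  rw [intervalIntegral.integral_add hf hg, hFy, hGy]
  ring

lemma sub (hF : IsPrimitiveOn a b F f) (hG : IsPrimitiveOn a b G g) :
    IsPrimitiveOn a b (fun x => F x - G x) (fun x => f x - g x) := by
  intro x hx y hy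
  obtain ⟨hf, hFy⟩ := hF x hx y hy
  obtain ⟨hg, hGy⟩ := hG x hx y hy
  refine ⟨hf.sub hg, ?_⟩
  beta_reduce
  rw [intervalIntegral.integral_sub hf hg, hFy, hGy]
  ring

lemma pow_succ (hF : IsPrimitiveOn a b F f) (n : ℕ) :
    IsPrimitiveOn a b (fun x => F x ^ (n + 1)) (fun x => (n + 1) * (f x * F x ^ n)) := by
  induction n with
  | zero => simpa using hF
  | succ n ih =>
    have := (ih.mul hF).congr (g := fun x => ((n + 1 : ℕ) + 1 : 𝕜) * (f x * F x ^ (n + 1)))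
      fun x _ => by push_cast; ring
    simpa only [← _root_.pow_succ] using this

lemma ofReal {F f : ℝ → ℝ} (hF : IsPrimitiveOn a b F f) :
    IsPrimitiveOn a b (fun x => (F x : ℂ)) (fun x => (f x : ℂ)) := by
  intro x hx y hy
  obtain ⟨hf, hFy⟩ := hF x hx y hy
  refine ⟨⟨hf.1.ofReal, hf.2.ofReal⟩, ?_⟩
  beta_reduce
  rw [hFy, intervalIntegral.integral_ofReal]
  push_cast
  rfl

lemma of_hasDerivAt (hd : ∀ x ∈ Ioo a b, HasDerivAt F (f x) x) (hc : ContinuousOn f (Ioo a b)) :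
    IsPrimitiveOn a b F f := by
  intro x hx y hy
  have hsub : uIcc x y ⊆ Ioo a b := OrdConnected.uIcc_subset inferInstance hx hy
  have hi : IntervalIntegrable f volume x y := (hc.mono hsub).intervalIntegrable
  refine ⟨hi, ?_⟩
  rw [intervalIntegral.integral_eq_sub_of_hasDerivAt (fun t ht => hd t (hsub ht)) hi]
  ring

end IsPrimitiveOn

lemma isPrimitiveOn_integral {a b x₀ : ℝ} (hx₀ : x₀ ∈ Ioo a b) {f : ℝ → 𝕜}
    (hf : ∀ x ∈ Ioo a b, ∀ y ∈ Ioo a b, IntervalIntegrable f volume x y) (C : 𝕜) :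
    IsPrimitiveOn a b (fun x => C + ∫ t in x₀..x, f t) f := by
  intro x hx y hy
  refine ⟨hf x hx y hy, ?_⟩
  beta_reduce
  rw [add_assoc, intervalIntegral.integral_add_adjacent_intervals (hf _ hx₀ _ hx) (hf _ hx _ hy)]

end Primitives

section Existence

variable {𝕜 : Type*} [RCLike 𝕜] {a b x₀ : ℝ}

lemma abs_integral_mul_abs_pow_le {m : ℝ → ℝ} (hx₀ : x₀ ∈ Ioo a b)
    (hm : ∀ x ∈ Ioo a b, ∀ y ∈ Ioo a b, IntervalIntegrable m volume x y) (hm0 : ∀ t, 0 ≤ m t)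
    (n : ℕ) {x : ℝ} (hx : x ∈ Ioo a b) :
    |∫ t in x₀..x, m t * |∫ s in x₀..t, m s| ^ n| ≤ |∫ s in x₀..x, m s| ^ (n + 1) / (n + 1) := by
  have hM : IsPrimitiveOn a b (fun x => ∫ t in x₀..x, m t) m := by
    simpa using isPrimitiveOn_integral hx₀ hm 0
  have key := ((hM.pow_succ n) x₀ hx₀ x hx).2
  simp only [intervalIntegral.integral_same, intervalIntegral.integral_const_mul] at key
  obtain ⟨σ, hσ, hσM⟩ : ∃ σ : ℝ, |σ| = 1 ∧
      ∀ t ∈ uIcc x₀ x, |∫ s in x₀..t, m s| = σ * ∫ s in x₀..t, m s := by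
    rcases le_total x₀ x with h | h
    · refine ⟨1, by simp, fun t ht => ?_⟩
      rw [uIcc_of_le h] at ht
      rw [one_mul, abs_of_nonneg (intervalIntegral.integral_nonneg ht.1 fun s _ => hm0 s)]
    · refine ⟨-1, by simp, fun t ht => ?_⟩
      rw [uIcc_of_ge h] at ht
      rw [intervalIntegral.integral_symm, abs_neg,
        abs_of_nonneg (intervalIntegral.integral_nonneg ht.2 fun s _ => hm0 s)]
      ring
  have hcongr : ∫ t in x₀..x, m t * |∫ s in x₀..t, m s| ^ n =
      σ ^ n * ∫ t in x₀..x, m t * (∫ s in x₀..t, m s) ^ n := by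
    rw [← intervalIntegral.integral_const_mul]
    refine intervalIntegral.integral_congr fun t ht => ?_
    rw [hσM t ht]; ring
  rw [hcongr, abs_mul, abs_pow, hσ, one_pow, one_mul, ← abs_pow, key, le_div_iff₀ (by positivity)]
  rw [zero_pow (by omega), zero_add, abs_mul, mul_comm]
  rw [abs_of_nonneg (by positivity : (0 : ℝ) ≤ n + 1)]

/-- Picard iterates for the system `u' = p v`, `v' = g u` with `u x₀ = ξ`, `v x₀ = η`: the `n`-th
term of the resulting series. -/
def picardTerm (p g : ℝ → 𝕜) (x₀ : ℝ) (ξ η : 𝕜) : ℕ → (ℝ → 𝕜) × (ℝ → 𝕜)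
  | 0 => (fun _ => ξ, fun _ => η)
  | n + 1 => (fun x => ∫ t in x₀..x, p t * (picardTerm p g x₀ ξ η n).2 t,
      fun x => ∫ t in x₀..x, g t * (picardTerm p g x₀ ξ η n).1 t)

lemma IntervalIntegrable.mul_continuousOn_Ioo {f h : ℝ → 𝕜}
    (hf : ∀ x ∈ Ioo a b, ∀ y ∈ Ioo a b, IntervalIntegrable f volume x y)
    (hh : ContinuousOn h (Ioo a b)) :
    ∀ x ∈ Ioo a b, ∀ y ∈ Ioo a b, IntervalIntegrable (fun t => f t * h t) volume x y :=
  fun x hx y hy => (hf x hx y hy).mul_continuousOn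
    (hh.mono (OrdConnected.uIcc_subset inferInstance hx hy))

lemma continuousOn_picardTerm {p g : ℝ → 𝕜} (hx₀ : x₀ ∈ Ioo a b)
    (hp : ∀ x ∈ Ioo a b, ∀ y ∈ Ioo a b, IntervalIntegrable p volume x y)
    (hg : ∀ x ∈ Ioo a b, ∀ y ∈ Ioo a b, IntervalIntegrable g volume x y) (ξ η : 𝕜) (n : ℕ) :
    ContinuousOn (picardTerm p g x₀ ξ η n).1 (Ioo a b) ∧
      ContinuousOn (picardTerm p g x₀ ξ η n).2 (Ioo a b) := by
  induction n with
  | zero => exact ⟨continuousOn_const, continuousOn_const⟩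
  | succ n ih =>
    have h1 := (isPrimitiveOn_integral hx₀
      (IntervalIntegrable.mul_continuousOn_Ioo hp ih.2) 0).continuousOn
    have h2 := (isPrimitiveOn_integral hx₀
      (IntervalIntegrable.mul_continuousOn_Ioo hg ih.1) 0).continuousOn
    simp only [zero_add] at h1 h2
    exact ⟨h1, h2⟩

lemma norm_integral_mul_le_of_le_pow {m : ℝ → ℝ} (hx₀ : x₀ ∈ Ioo a b)
    (hm : ∀ x ∈ Ioo a b, ∀ y ∈ Ioo a b, IntervalIntegrable m volume x y) {c w : ℝ → 𝕜}
    (hc : ∀ t, ‖c t‖ ≤ m t) {C : ℝ} (hC : 0 ≤ C) {n : ℕ}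
    (hw : ∀ t ∈ Ioo a b, ‖w t‖ ≤ C * (|∫ s in x₀..t, m s| ^ n / n.factorial)) {x : ℝ}
    (hx : x ∈ Ioo a b) :
    ‖∫ t in x₀..x, c t * w t‖ ≤
      C * (|∫ s in x₀..x, m s| ^ (n + 1) / (n + 1).factorial) := by
  have hm0 : ∀ t, 0 ≤ m t := fun t => (norm_nonneg _).trans (hc t)
  have hM : IsPrimitiveOn a b (fun x => ∫ t in x₀..x, m t) m := by
    simpa using isPrimitiveOn_integral hx₀ hm 0
  have hsub : uIcc x₀ x ⊆ Ioo a b := OrdConnected.uIcc_subset inferInstance hx₀ hx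
  have hint := IntervalIntegrable.mul_continuousOn_Ioo hm (hM.continuousOn.abs.pow n) x₀ hx₀ x hx
  calc ‖∫ t in x₀..x, c t * w t‖
      ≤ |∫ t in x₀..x, (C / n.factorial) * (m t * |∫ s in x₀..t, m s| ^ n)| := by
        refine intervalIntegral.norm_integral_le_abs_of_norm_le ?_ (hint.const_mul _)
        refine (ae_restrict_iff' measurableSet_uIoc).2 (ae_of_all _ fun t ht => ?_)
        rw [norm_mul]
        calc ‖c t‖ * ‖w t‖ ≤ m t * (C * (|∫ s in x₀..t, m s| ^ n / n.factorial)) :=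
              mul_le_mul (hc t) (hw t (hsub (uIoc_subset_uIcc ht))) (norm_nonneg _) (hm0 t)
          _ = _ := by ring
    _ = (C / n.factorial) * |∫ t in x₀..x, m t * |∫ s in x₀..t, m s| ^ n| := by
        rw [intervalIntegral.integral_const_mul, abs_mul, abs_of_nonneg (by positivity)]
    _ ≤ (C / n.factorial) * (|∫ s in x₀..x, m s| ^ (n + 1) / (n + 1)) := by
        gcongr
        exact abs_integral_mul_abs_pow_le hx₀ hm hm0 n hx
    _ = _ := by
        rw [Nat.factorial_succ]
        push_cast
        field_simp

lemma norm_picardTerm_le {p g : ℝ → 𝕜} (hx₀ : x₀ ∈ Ioo a b)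
    (hp : ∀ x ∈ Ioo a b, ∀ y ∈ Ioo a b, IntervalIntegrable p volume x y)
    (hg : ∀ x ∈ Ioo a b, ∀ y ∈ Ioo a b, IntervalIntegrable g volume x y) (ξ η : 𝕜) (n : ℕ) :
    ∀ x ∈ Ioo a b,
      ‖(picardTerm p g x₀ ξ η n).1 x‖ ≤
        (‖ξ‖ + ‖η‖) * (|∫ s in x₀..x, (‖p s‖ + ‖g s‖)| ^ n / n.factorial) ∧
      ‖(picardTerm p g x₀ ξ η n).2 x‖ ≤
        (‖ξ‖ + ‖η‖) * (|∫ s in x₀..x, (‖p s‖ + ‖g s‖)| ^ n / n.factorial) := by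
  have hm : ∀ x ∈ Ioo a b, ∀ y ∈ Ioo a b,
      IntervalIntegrable (fun s => ‖p s‖ + ‖g s‖) volume x y :=
    fun x hx y hy => (hp x hx y hy).norm.add (hg x hx y hy).norm
  induction n with
  | zero => intro x _; simp [picardTerm]
  | succ n ih =>
    intro x hx
    exact ⟨norm_integral_mul_le_of_le_pow hx₀ hm (fun t => le_add_of_nonneg_right (norm_nonneg _))
        (by positivity) (fun t ht => (ih t ht).2) hx,
      norm_integral_mul_le_of_le_pow hx₀ hm (fun t => le_add_of_nonneg_left (norm_nonneg _))
        (by positivity) (fun t ht => (ih t ht).1) hx⟩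

lemma isPrimitiveOn_tsum (hx₀ : x₀ ∈ Ioo a b) {c : ℝ → 𝕜}
    (hc : ∀ x ∈ Ioo a b, ∀ y ∈ Ioo a b, IntervalIntegrable c volume x y) {w y : ℕ → ℝ → 𝕜}
    (hwc : ∀ n, ContinuousOn (w n) (Ioo a b)) (hys : ∀ x ∈ Ioo a b, Summable fun n => y n x)
    (hw : ∀ K ⊆ Ioo a b, IsCompact K →
      ∃ B : ℕ → ℝ, Summable B ∧ ∀ n, ∀ x ∈ K, ‖w n x‖ ≤ B n)
    {ξ : 𝕜} (hy0 : ∀ x, y 0 x = ξ) (hy : ∀ n x, y (n + 1) x = ∫ t in x₀..x, c t * w n t) :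
    IsPrimitiveOn a b (fun x => ∑' n, y n x) (fun x => c x * ∑' n, w n x) := by
  have hsub : ∀ {x z : ℝ}, x ∈ Ioo a b → z ∈ Ioo a b → uIcc x z ⊆ Ioo a b :=
    fun hx hz => OrdConnected.uIcc_subset inferInstance hx hz
  have hint : ∀ x ∈ Ioo a b, ∀ z ∈ Ioo a b,
      IntervalIntegrable (fun x => c x * ∑' n, w n x) volume x z := by
    intro x hx z hz
    obtain ⟨B, hB, hwB⟩ := hw _ (hsub hx hz) isCompact_uIcc
    exact (hc x hx z hz).mul_continuousOn
      (continuousOn_tsum (fun n => (hwc n).mono (hsub hx hz)) hB hwB)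
  have hsum : ∀ x ∈ Ioo a b, ∑' n, y n x = ξ + ∫ t in x₀..x, c t * ∑' n, w n t := by
    intro x hx
    obtain ⟨B, hB, hwB⟩ := hw _ (hsub hx₀ hx) isCompact_uIcc
    have key : HasSum (fun n => ∫ t in x₀..x, c t * w n t)
        (∫ t in x₀..x, c t * ∑' n, w n t) := by
      refine intervalIntegral.hasSum_integral_of_dominated_convergence
        (fun n t => ‖c t‖ * B n) (fun n => ?_) (fun n => ae_of_all _ fun t ht => ?_)
        (ae_of_all _ fun t _ => hB.mul_left _) ?_ (ae_of_all _ fun t ht => ?_)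
      · exact (IntervalIntegrable.mul_continuousOn_Ioo hc (hwc n) x₀ hx₀ x
          hx).aestronglyMeasurable_restrict_uIoc
      · rw [norm_mul]
        exact mul_le_mul_of_nonneg_left (hwB n t (uIoc_subset_uIcc ht)) (norm_nonneg _)
      · simp only [tsum_mul_left]
        exact (hc x₀ hx₀ x hx).norm.mul_const _
      · exact (hB.of_norm_bounded fun n => hwB n t (uIoc_subset_uIcc ht)).hasSum.mul_left _
    rw [(hys x hx).tsum_eq_zero_add, hy0]
    simp only [hy]
    rw [key.tsum_eq]
  have := (isPrimitiveOn_integral hx₀ hint ξ)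
  intro x hx z hz
  refine ⟨hint x hx z hz, ?_⟩
  have h := (this x hx z hz).2
  beta_reduce at h ⊢
  rw [hsum x hx, hsum z hz, h]

/-- Existence for linear systems `u' = p v`, `v' = g u` with locally integrable coefficients. -/
lemma exists_isPrimitiveOn_system {p g : ℝ → 𝕜} (hx₀ : x₀ ∈ Ioo a b)
    (hp : ∀ x ∈ Ioo a b, ∀ y ∈ Ioo a b, IntervalIntegrable p volume x y)
    (hg : ∀ x ∈ Ioo a b, ∀ y ∈ Ioo a b, IntervalIntegrable g volume x y) (ξ η : 𝕜) :
    ∃ u v : ℝ → 𝕜, IsPrimitiveOn a b u (fun t => p t * v t) ∧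
      IsPrimitiveOn a b v (fun t => g t * u t) ∧ u x₀ = ξ ∧ v x₀ = η := by
  have hm : ∀ x ∈ Ioo a b, ∀ y ∈ Ioo a b,
      IntervalIntegrable (fun s => ‖p s‖ + ‖g s‖) volume x y :=
    fun x hx y hy => (hp x hx y hy).norm.add (hg x hx y hy).norm
  have hM := (isPrimitiveOn_integral hx₀ hm 0).continuousOn
  simp only [zero_add] at hM
  have hcont := continuousOn_picardTerm hx₀ hp hg ξ η
  have hbound : ∀ K ⊆ Ioo a b, IsCompact K → ∃ B : ℕ → ℝ, Summable B ∧ ∀ n, ∀ x ∈ K,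
      ‖(picardTerm p g x₀ ξ η n).1 x‖ ≤ B n ∧ ‖(picardTerm p g x₀ ξ η n).2 x‖ ≤ B n := by
    intro K hK hKc
    obtain ⟨D, hD⟩ := hKc.exists_bound_of_continuousOn (hM.mono hK)
    refine ⟨fun n => (‖ξ‖ + ‖η‖) * (D ^ n / n.factorial),
      (Real.summable_pow_div_factorial D).mul_left _, fun n x hx => ?_⟩
    have hle : (‖ξ‖ + ‖η‖) * (|∫ s in x₀..x, (‖p s‖ + ‖g s‖)| ^ n / n.factorial) ≤
        (‖ξ‖ + ‖η‖) * (D ^ n / n.factorial) := by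
      gcongr
      exact hD x hx
    have := norm_picardTerm_le hx₀ hp hg ξ η n x (hK hx)
    exact ⟨this.1.trans hle, this.2.trans hle⟩
  have hb1 : ∀ K ⊆ Ioo a b, IsCompact K → ∃ B : ℕ → ℝ, Summable B ∧ ∀ n, ∀ x ∈ K,
      ‖(picardTerm p g x₀ ξ η n).1 x‖ ≤ B n := fun K hK hKc =>
    let ⟨B, hB, h⟩ := hbound K hK hKc; ⟨B, hB, fun n x hx => (h n x hx).1⟩
  have hb2 : ∀ K ⊆ Ioo a b, IsCompact K → ∃ B : ℕ → ℝ, Summable B ∧ ∀ n, ∀ x ∈ K,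
      ‖(picardTerm p g x₀ ξ η n).2 x‖ ≤ B n := fun K hK hKc =>
    let ⟨B, hB, h⟩ := hbound K hK hKc; ⟨B, hB, fun n x hx => (h n x hx).2⟩
  have hs1 : ∀ x ∈ Ioo a b, Summable fun n => (picardTerm p g x₀ ξ η n).1 x := fun x hx =>
    let ⟨_, hB, h⟩ := hb1 {x} (singleton_subset_iff.2 hx) isCompact_singleton
    hB.of_norm_bounded fun n => h n x rfl
  have hs2 : ∀ x ∈ Ioo a b, Summable fun n => (picardTerm p g x₀ ξ η n).2 x := fun x hx =>
    let ⟨_, hB, h⟩ := hb2 {x} (singleton_subset_iff.2 hx) isCompact_singleton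
    hB.of_norm_bounded fun n => h n x rfl
  refine ⟨fun x => ∑' n, (picardTerm p g x₀ ξ η n).1 x, fun x => ∑' n, (picardTerm p g x₀ ξ η n).2 x,
    isPrimitiveOn_tsum hx₀ hp (fun n => (hcont n).2) hs1 hb2 (ξ := ξ) (fun _ => rfl) fun _ _ => rfl,
    isPrimitiveOn_tsum hx₀ hg (fun n => (hcont n).1) hs2 hb1 (ξ := η) (fun _ => rfl) fun _ _ => rfl,
    ?_, ?_⟩
  · beta_reduce
    rw [(hs1 x₀ hx₀).tsum_eq_zero_add]
    simp [picardTerm]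
  · beta_reduce
    rw [(hs2 x₀ hx₀).tsum_eq_zero_add]
    simp [picardTerm]

end Existence

section Comparison

variable {R α : ℝ} {Q : ℝ → ℝ}

lemma intervalIntegrable_rpow_of_mem_Ioo (s : ℝ) :
    ∀ x ∈ Ioo 0 R, ∀ y ∈ Ioo 0 R, IntervalIntegrable (fun t : ℝ => t ^ s) volume x y := by
  intro x hx y hy
  refine intervalIntegral.intervalIntegrable_rpow (Or.inr fun h => ?_)
  exact lt_irrefl _ ((OrdConnected.uIcc_subset inferInstance hx hy : uIcc x y ⊆ Ioo 0 R) h).1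

lemma isPrimitiveOn_rpow (s : ℝ) :
    IsPrimitiveOn 0 R (fun x : ℝ => x ^ s) (fun x => s * x ^ (s - 1)) :=
  .of_hasDerivAt (fun _ hx => Real.hasDerivAt_rpow_const (Or.inl hx.1.ne'))
    (continuousOn_const.mul
      (continuousOn_id.rpow_const fun _ hx => Or.inl hx.1.ne'))

/-- If `Q ≥ (3 - 2 α) / 4 * x ^ (α - 2)` near `0`, then `τ u = 0` has a real solution dominating
the solution `x ^ (-1 / 2)` of the comparison equation near `0`. -/
lemma exists_solution_ge_rpow (hQ : ∀ x ∈ Ioo 0 R, ∀ y ∈ Ioo 0 R, IntervalIntegrable Q volume x y)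
    {r : ℝ} (hr : r ∈ Ioo 0 R)
    (hle : ∀ᵐ x : ℝ, x ∈ Ioo 0 r → (3 - 2 * α) / 4 * x ^ (α - 2) ≤ Q x) :
    ∃ u v : ℝ → ℝ, IsPrimitiveOn 0 R u (fun t => t ^ (-α) * v t) ∧
      IsPrimitiveOn 0 R v (fun t => Q t * u t) ∧
      ∃ c ∈ Ioo 0 R, ∀ x ∈ Ioc 0 c, x ^ (-(1 / 2) : ℝ) ≤ u x := by
  obtain ⟨c, hc0, hcr⟩ := exists_between hr.1
  have hc : c ∈ Ioo 0 R := ⟨hc0, hcr.trans hr.2⟩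
  obtain ⟨y, w, hy, hw, hyc, hwc⟩ := exists_isPrimitiveOn_system hc
    (intervalIntegrable_rpow_of_mem_Ioo (-α)) hQ (c ^ (-(1 / 2) : ℝ)) (-(1 / 2) * c ^ (α - 3 / 2))
  refine ⟨y, w, hy, hw, c, hc, ?_⟩
  have hG : IsPrimitiveOn 0 R
      (fun x => x ^ (-(1 / 2) : ℝ) * w x + y x * ((1 / 2) * x ^ (α - 3 / 2)))
      (fun x => x ^ (-(1 / 2) : ℝ) * y x * (Q x - (3 - 2 * α) / 4 * x ^ (α - 2))) := by
    have hconst : IsPrimitiveOn 0 R (fun _ : ℝ => (1 / 2 : ℝ)) (fun _ => 0) :=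
      .of_hasDerivAt (fun x _ => hasDerivAt_const x _) continuousOn_const
    refine (((isPrimitiveOn_rpow (-(1 / 2))).mul hw).add
      (hy.mul (hconst.mul (isPrimitiveOn_rpow (α - 3 / 2))))).congr fun x hx => ?_
    have e1 : x ^ (-(1 / 2) - 1 : ℝ) = x ^ (-α) * x ^ (α - 3 / 2) := by
      rw [← Real.rpow_add hx.1]; ring_nf
    have e2 : x ^ (α - 3 / 2 - 1 : ℝ) = x ^ (-(1 / 2) : ℝ) * x ^ (α - 2) := by
      rw [← Real.rpow_add hx.1]; ring_nf
    beta_reduce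
    rw [e1, e2]
    ring
  have hH : IsPrimitiveOn 0 R (fun x => y x * x ^ (1 / 2 : ℝ))
      (fun x => x ^ (1 - α) *
        (x ^ (-(1 / 2) : ℝ) * w x + y x * ((1 / 2) * x ^ (α - 3 / 2)))) := by
    refine (hy.mul (isPrimitiveOn_rpow (1 / 2))).congr fun x hx => ?_
    have e1 : x ^ (-α) * x ^ (1 / 2 : ℝ) = x ^ (1 - α) * x ^ (-(1 / 2) : ℝ) := by
      rw [← Real.rpow_add hx.1, ← Real.rpow_add hx.1]; ring_nf
    have e2 : x ^ (1 / 2 - 1 : ℝ) = x ^ (1 - α) * x ^ (α - 3 / 2) := by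
      rw [← Real.rpow_add hx.1]; ring_nf
    beta_reduce
    rw [e2]
    linear_combination w x * e1
  have hGc : c ^ (-(1 / 2) : ℝ) * w c + y c * ((1 / 2) * c ^ (α - 3 / 2)) = 0 := by
    rw [hyc, hwc]; ring
  have hHc : y c * c ^ (1 / 2 : ℝ) = 1 := by
    rw [hyc, ← Real.rpow_add hc0]; norm_num
  have hmem : ∀ {x t : ℝ}, 0 < x → x ≤ t → t ≤ c → t ∈ Ioo 0 R :=
    fun h0 h1 h2 => ⟨h0.trans_le h1, h2.trans_lt hc.2⟩
  have hstep : ∀ x ∈ Ioc 0 c, (∀ t ∈ Ioc x c, 0 < y t) → 1 ≤ y x * x ^ (1 / 2 : ℝ) := by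
    intro x hx hpos
    have hGle : ∀ t ∈ Icc x c,
        t ^ (-(1 / 2) : ℝ) * w t + y t * ((1 / 2) * t ^ (α - 3 / 2)) ≤ 0 := by
      intro t ht
      have h := (hG t (hmem hx.1 ht.1 ht.2) c hc).2
      beta_reduce at h
      rw [hGc] at h
      have hnn : 0 ≤ ∫ s in t..c,
          s ^ (-(1 / 2) : ℝ) * y s * (Q s - (3 - 2 * α) / 4 * s ^ (α - 2)) := by
        rw [intervalIntegral.integral_of_le ht.2]
        refine integral_nonneg_of_ae ((ae_restrict_iff' measurableSet_Ioc).2 ?_)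
        filter_upwards [hle] with s hs hst
        have hs0 : 0 < s := hx.1.trans (ht.1.trans_lt hst.1)
        exact mul_nonneg (mul_nonneg (Real.rpow_nonneg hs0.le _)
          (hpos s ⟨ht.1.trans_lt hst.1, hst.2⟩).le)
          (sub_nonneg.2 (hs ⟨hs0, hst.2.trans_lt hcr⟩))
      linarith
    have h := (hH x (hmem hx.1 le_rfl hx.2) c hc).2
    beta_reduce at h
    rw [hHc] at h
    have hnp : ∫ s in x..c, s ^ (1 - α) *
        (s ^ (-(1 / 2) : ℝ) * w s + y s * ((1 / 2) * s ^ (α - 3 / 2))) ≤ 0 := by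
      rw [intervalIntegral.integral_of_le hx.2]
      refine setIntegral_nonpos measurableSet_Ioc fun s hs => ?_
      exact mul_nonpos_of_nonneg_of_nonpos (Real.rpow_nonneg (hx.1.trans hs.1).le _)
        (hGle s ⟨hs.1.le, hs.2⟩)
    linarith
  have hpos : ∀ x ∈ Ioc 0 c, 0 < y x := by
    intro x hx
    by_contra hneg
    have hcont : ContinuousOn y (Icc x c) :=
      hy.continuousOn.mono fun t ht => hmem hx.1 ht.1 ht.2
    have hclosed : IsClosed (Icc x c ∩ y ⁻¹' Iic 0) :=
      hcont.preimage_isClosed_of_isClosed isClosed_Icc isClosed_Iic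
    have hcomp : IsCompact (Icc x c ∩ y ⁻¹' Iic 0) :=
      isCompact_Icc.of_isClosed_subset hclosed inter_subset_left
    obtain ⟨s, ⟨hs, hys⟩, hmax⟩ := hcomp.exists_isGreatest ⟨x, ⟨le_rfl, hx.2⟩, not_lt.1 hneg⟩
    have hs0 : 0 < s := hx.1.trans_le hs.1
    have h1 := hstep s ⟨hs0, hs.2⟩ fun t ht => by
      by_contra ht0
      exact absurd (hmax ⟨⟨hs.1.trans ht.1.le, ht.2⟩, not_lt.1 ht0⟩) (not_le.2 ht.1)
    have h2 : y s * s ^ (1 / 2 : ℝ) ≤ 0 :=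
      mul_nonpos_of_nonpos_of_nonneg hys (Real.rpow_nonneg hs0.le _)
    linarith
  intro x hx
  have h := hstep x hx fun t ht => hpos t ⟨hx.1.trans ht.1, ht.2⟩
  rw [Real.rpow_neg hx.1.le, inv_le_iff_one_le_mul₀ (Real.rpow_pos_of_pos hx.1 _)]
  exact h

end Comparison

section LimitPoint

variable {R α : ℝ} {Q : ℝ → ℝ}

/-- If `a` and `b` are primitives with derivatives bounded by `k (‖a‖ + ‖b‖)`, where `k` is
integrable near the left endpoint, then they are bounded near that endpoint. -/
lemma IsPrimitiveOn.exists_bound_near_left {a b a' b' : ℝ → ℂ} (ha : IsPrimitiveOn 0 R a a')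
    (hb : IsPrimitiveOn 0 R b b') {k : ℝ → ℝ} {c : ℝ} (hc : c ∈ Ioo 0 R)
    (hk : IntervalIntegrable k volume 0 c)
    (hk0 : ∀ t, 0 ≤ k t)
    (hle : ∀ t ∈ Ioo 0 R, ‖a' t‖ + ‖b' t‖ ≤ k t * (‖a t‖ + ‖b t‖)) :
    ∃ δ ∈ Ioc 0 c, ∃ B : ℝ, ∀ x ∈ Ioc 0 δ, ‖a x‖ + ‖b x‖ ≤ B := by
  obtain ⟨δ, hδ, hδk⟩ : ∃ δ ∈ Ioc 0 c, ∫ t in (0 : ℝ)..δ, k t ≤ 1 / 2 := by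
    have hcont := intervalIntegral.continuousOn_primitive_interval' hk (a := 0) left_mem_uIcc
    rw [uIcc_of_le hc.1.le] at hcont
    have h0 := (hcont 0 (left_mem_Icc.2 hc.1.le)).tendsto
    rw [intervalIntegral.integral_same] at h0
    have h1 := h0.eventually (ge_mem_nhds (show (0 : ℝ) < 1 / 2 by norm_num))
    have h2 := h1.filter_mono (nhdsWithin_mono 0 (Ioc_subset_Icc_self : Ioc 0 c ⊆ Icc 0 c))
    rw [nhdsWithin_Ioc_eq_nhdsGT hc.1] at h2
    have h3 : ∀ᶠ t in nhdsWithin (0 : ℝ) (Ioi 0), t ∈ Ioc 0 c := Ioc_mem_nhdsGT hc.1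
    obtain ⟨δ, h4, h5⟩ := (h2.and h3).exists
    exact ⟨δ, h5, h4⟩
  have hδR : δ ∈ Ioo 0 R := ⟨hδ.1, hδ.2.trans_lt hc.2⟩
  refine ⟨δ, hδ, 2 * (‖a δ‖ + ‖b δ‖), fun x hx => ?_⟩
  have hsub : Icc x δ ⊆ Ioo 0 R := fun t ht => ⟨hx.1.trans_le ht.1, ht.2.trans_lt hδR.2⟩
  have hcont : ContinuousOn (fun t => ‖a t‖ + ‖b t‖) (Icc x δ) :=
    (ha.continuousOn.norm.add hb.continuousOn.norm).mono hsub
  obtain ⟨s, hs, hmax⟩ := isCompact_Icc.exists_isMaxOn ⟨x, left_mem_Icc.2 hx.2⟩ hcont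
  have hsR := hsub hs
  have hmax' : ∀ t ∈ Icc x δ, ‖a t‖ + ‖b t‖ ≤ ‖a s‖ + ‖b s‖ := fun t ht => hmax ht
  obtain ⟨ia, ea⟩ := ha s hsR δ hδR
  obtain ⟨ib, eb⟩ := hb s hsR δ hδR
  have hks : IntervalIntegrable k volume s δ := hk.mono_set (by
    rw [uIcc_of_le hs.2, uIcc_of_le hc.1.le]
    exact Icc_subset_Icc hsR.1.le hδ.2)
  have hk0s : IntervalIntegrable k volume 0 s := hk.mono_set (by
    rw [uIcc_of_le hsR.1.le, uIcc_of_le hc.1.le]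
    exact Icc_subset_Icc le_rfl (hs.2.trans hδ.2))
  have hint : ∫ t in s..δ, (‖a' t‖ + ‖b' t‖) ≤ ∫ t in s..δ, k t * (‖a s‖ + ‖b s‖) := by
    refine intervalIntegral.integral_mono_on hs.2 (ia.norm.add ib.norm) (hks.mul_const _) ?_
    intro t ht
    have ht' : t ∈ Icc x δ := ⟨hs.1.trans ht.1, ht.2⟩
    exact (hle t (hsub ht')).trans (mul_le_mul_of_nonneg_left (hmax' t ht') (hk0 t))
  rw [intervalIntegral.integral_add ia.norm ib.norm, intervalIntegral.integral_mul_const] at hint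
  have na := intervalIntegral.norm_integral_le_integral_norm (f := a') (μ := volume) hs.2
  have nb := intervalIntegral.norm_integral_le_integral_norm (f := b') (μ := volume) hs.2
  have ta : ‖a s‖ ≤ ‖a δ‖ + ‖∫ t in s..δ, a' t‖ := by
    rw [eq_sub_of_add_eq ea.symm]; exact norm_sub_le _ _
  have tb : ‖b s‖ ≤ ‖b δ‖ + ‖∫ t in s..δ, b' t‖ := by
    rw [eq_sub_of_add_eq eb.symm]; exact norm_sub_le _ _
  have hks2 : ∫ t in s..δ, k t ≤ 1 / 2 := by
    have h1 := intervalIntegral.integral_add_adjacent_intervals hk0s hks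
    have h2 := intervalIntegral.integral_nonneg (μ := volume) hsR.1.le fun t _ => hk0 t
    linarith
  have hN : 0 ≤ ‖a s‖ + ‖b s‖ := by positivity
  have := mul_le_mul_of_nonneg_right hks2 hN
  have := hmax' x (left_mem_Icc.2 hx.2)
  linarith

lemma integrableOn_norm_sq_of_lintegral_ne_top {u : ℝ → ℂ} {c : ℝ}
    (hu : ContinuousOn u (Ioo 0 c))
    (h : (∫⁻ x in Ioo (0 : ℝ) c, (‖u x‖₊ : ℝ≥0∞) ^ 2) ≠ ⊤) :
    IntegrableOn (fun x => ‖u x‖ ^ 2) (Ioo 0 c) := by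
  refine ⟨(hu.norm.pow 2).aestronglyMeasurable measurableSet_Ioo, ?_⟩
  rw [hasFiniteIntegral_iff_enorm]
  refine lt_of_eq_of_lt (lintegral_congr fun x => ?_) h.lt_top
  rw [enorm_pow, enorm_norm]
  rfl

/-- Weyl's alternative: if `τ u = 0` has a solution dominating `x ^ (-1 / 2)` near `0`, then
`τ` is in the limit point case at `0`. -/
lemma limitPointAtZero_of_solution_ge
    (hQ : ∀ x ∈ Ioo 0 R, ∀ y ∈ Ioo 0 R, IntervalIntegrable Q volume x y)
    {y w : ℝ → ℝ} (hy : IsPrimitiveOn 0 R y (fun t => t ^ (-α) * w t))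
    (hw : IsPrimitiveOn 0 R w (fun t => Q t * y t)) {c : ℝ} (hc : c ∈ Ioo 0 R)
    (hge : ∀ x ∈ Ioc 0 c, x ^ (-(1 / 2) : ℝ) ≤ y x) : LimitPointAtZero R α Q := by
  intro z
  by_contra! hcon
  have hp : ∀ x ∈ Ioo 0 R, ∀ y ∈ Ioo 0 R,
      IntervalIntegrable (fun t : ℝ => ((t ^ (-α) : ℝ) : ℂ)) volume x y := fun x hx y hy =>
    have h := intervalIntegrable_rpow_of_mem_Ioo (-α) x hx y hy
    ⟨h.1.ofReal, h.2.ofReal⟩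
  have hg : ∀ x ∈ Ioo 0 R, ∀ y ∈ Ioo 0 R,
      IntervalIntegrable (fun t : ℝ => (Q t : ℂ) - z) volume x y := fun x hx y hy =>
    have h := hQ x hx y hy
    IntervalIntegrable.sub ⟨h.1.ofReal, h.2.ofReal⟩ intervalIntegrable_const
  have hL2 : ∀ u v : ℝ → ℂ, IsPrimitiveOn 0 R u (fun t => ((t ^ (-α) : ℝ) : ℂ) * v t) →
      IsPrimitiveOn 0 R v (fun t => ((Q t : ℂ) - z) * u t) →
      IntegrableOn (fun x => ‖u x‖ ^ 2) (Ioo 0 c) := fun u v hu hv =>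
    integrableOn_norm_sq_of_lintegral_ne_top
      (hu.continuousOn.mono (Ioo_subset_Ioo le_rfl hc.2.le))
      (hcon u v (fun x hx x₀ hx₀ => ⟨(hu x₀ hx₀ x hx).2, (hv x₀ hx₀ x hx).2⟩) c hc)
  obtain ⟨u₁, v₁, hu₁, hv₁, hu₁c, hv₁c⟩ := exists_isPrimitiveOn_system hc hp hg 1 0
  obtain ⟨u₂, v₂, hu₂, hv₂, hu₂c, hv₂c⟩ := exists_isPrimitiveOn_system hc hp hg 0 1
  have hW : ∀ x ∈ Ioo 0 R, u₁ x * v₂ x - u₂ x * v₁ x = 1 := by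
    intro x hx
    have h := ((((hu₁.mul hv₂).sub (hu₂.mul hv₁)).congr (g := fun _ => 0)
      fun t _ => by beta_reduce; ring) c hc x hx).2
    simpa [hu₁c, hv₁c, hu₂c, hv₂c] using h
  have hyC := hy.ofReal
  have hwC := hw.ofReal
  have ha := ((hyC.mul hv₂).sub (hu₂.mul hwC)).congr (g := fun t => -z * u₂ t * y t)
    fun t _ => by push_cast; ring
  have hb := ((hu₁.mul hwC).sub (hyC.mul hv₁)).congr (g := fun t => z * u₁ t * y t)
    fun t _ => by push_cast; ring
  have hrep : ∀ x ∈ Ioo 0 R, (y x : ℂ) = (y x * v₂ x - u₂ x * w x) * u₁ x +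
      (u₁ x * w x - y x * v₁ x) * u₂ x := by
    intro x hx
    linear_combination -(y x : ℂ) * hW x hx
  have hyle : ∀ x ∈ Ioo 0 R, ‖(y x : ℂ)‖ ≤ (‖u₁ x‖ + ‖u₂ x‖) *
      (‖(y x : ℂ) * v₂ x - u₂ x * w x‖ + ‖u₁ x * w x - (y x : ℂ) * v₁ x‖) := by
    intro x hx
    calc ‖(y x : ℂ)‖ ≤ ‖(y x : ℂ) * v₂ x - u₂ x * w x‖ * ‖u₁ x‖ +
          ‖u₁ x * w x - (y x : ℂ) * v₁ x‖ * ‖u₂ x‖ := by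
          rw [← norm_mul, ← norm_mul]
          exact (congrArg norm (hrep x hx)).le.trans (norm_add_le _ _)
      _ ≤ _ := by
          have := norm_nonneg (u₁ x)
          have := norm_nonneg (u₂ x)
          have h1 := norm_nonneg ((y x : ℂ) * v₂ x - u₂ x * w x)
          have h2 := norm_nonneg (u₁ x * w x - (y x : ℂ) * v₁ x)
          nlinarith [mul_nonneg h1 (norm_nonneg (u₂ x)), mul_nonneg h2 (norm_nonneg (u₁ x))]
  have hkI : IntegrableOn (fun x => (‖u₁ x‖ + ‖u₂ x‖) ^ 2) (Ioo 0 c) := by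
    have hcont : ∀ {u u' : ℝ → ℂ}, IsPrimitiveOn 0 R u u' → ContinuousOn u (Ioo 0 c) :=
      fun h => h.continuousOn.mono (Ioo_subset_Ioo le_rfl hc.2.le)
    refine (((hL2 u₁ v₁ hu₁ hv₁).const_mul 2).add ((hL2 u₂ v₂ hu₂ hv₂).const_mul 2)).mono'
      ((((hcont hu₁).norm.add (hcont hu₂).norm).pow 2).aestronglyMeasurable measurableSet_Ioo)
      (ae_of_all _ fun x => ?_)
    simp only [Pi.add_apply]
    rw [Real.norm_of_nonneg (by positivity)]
    nlinarith [sq_nonneg (‖u₁ x‖ - ‖u₂ x‖)]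
  have hk : IntervalIntegrable (fun x => (‖u₁ x‖ + ‖u₂ x‖) ^ 2) volume 0 c :=
    (intervalIntegrable_iff_integrableOn_Ioo_of_le hc.1.le).2 hkI
  obtain ⟨δ, hδ, B, hB⟩ := ha.exists_bound_near_left hb hc (hk.const_mul ‖z‖)
    (fun t => by positivity) fun t ht => by
      have h := mul_le_mul_of_nonneg_left (hyle t ht)
        (by positivity : 0 ≤ ‖z‖ * (‖u₁ t‖ + ‖u₂ t‖))
      simp only [norm_mul, norm_neg]
      nlinarith
  have hinv : IntervalIntegrable (fun x : ℝ => x⁻¹) volume 0 δ := by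
    rw [intervalIntegrable_iff_integrableOn_Ioo_of_le hδ.1.le]
    refine Integrable.mono' ((hkI.mono_set (Ioo_subset_Ioo le_rfl hδ.2)).const_mul (B ^ 2))
      measurable_inv.aestronglyMeasurable ((ae_restrict_iff' measurableSet_Ioo).2
        (ae_of_all _ fun x hx => ?_))
    have hx0 : 0 < x := hx.1
    have hxR : x ∈ Ioo 0 R := ⟨hx0, hx.2.trans_le (hδ.2.trans hc.2.le)⟩
    have h1 := hge x ⟨hx0, hx.2.le.trans hδ.2⟩
    have h0 := Real.rpow_pos_of_pos hx0 (-(1 / 2))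
    have h2 := hyle x hxR
    rw [Complex.norm_real, Real.norm_of_nonneg (h0.le.trans h1)] at h2
    have h3 := h1.trans (h2.trans (mul_le_mul_of_nonneg_left (hB x ⟨hx0, hx.2.le⟩)
      (by positivity)))
    rw [Real.norm_of_nonneg (inv_nonneg.2 hx0.le)]
    calc x⁻¹ = (x ^ (-(1 / 2) : ℝ)) ^ 2 := by
          rw [← Real.rpow_natCast, ← Real.rpow_mul hx0.le, ← Real.rpow_neg_one]; norm_num
      _ ≤ ((‖u₁ x‖ + ‖u₂ x‖) * B) ^ 2 := by gcongr
      _ = B ^ 2 * (‖u₁ x‖ + ‖u₂ x‖) ^ 2 := by ring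
  rcases intervalIntegrable_inv_iff.1 hinv with h | h
  · exact hδ.1.ne h
  · exact h left_mem_uIcc

lemma nonoscillatoryAtZero_of_solution_ge {y w : ℝ → ℝ}
    (hy : IsPrimitiveOn 0 R y (fun t => t ^ (-α) * w t))
    (hw : IsPrimitiveOn 0 R w (fun t => Q t * y t)) {c : ℝ} (hc : c ∈ Ioo 0 R)
    (hge : ∀ x ∈ Ioc 0 c, x ^ (-(1 / 2) : ℝ) ≤ y x) : NonoscillatoryAtZero R α Q := by
  have hpos : ∀ x ∈ Ioc 0 c, 0 < y x := fun x hx =>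
    (Real.rpow_pos_of_pos hx.1 _).trans_le (hge x hx)
  refine ⟨y, w, fun x hx x₀ hx₀ => ⟨(hy x₀ hx₀ x hx).2, ?_⟩,
    fun h => (hpos c ⟨hc.1, le_rfl⟩).ne' (h c hc).1, c, hc, ?_⟩
  · simpa only [sub_zero] using (hw x₀ hx₀ x hx).2
  · convert Set.finite_empty
    exact eq_empty_of_forall_notMem fun x hx => (hpos x ⟨hx.1.1, hx.1.2.le⟩).ne' hx.2

end LimitPoint

theorem statement10 (n : ℕ) (hn : 2 ≤ n) (l : ℕ) (α : ℝ) (R : ℝ) (hR : 0 < R)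
    (q : ℝ → ℝ) (hq_meas : Measurable q)
    (hq_loc : LocallyIntegrableOn q (Ioo (0 : ℝ) R))
    (r₁ : ℝ) (hr₁ : r₁ ∈ Ioo (0 : ℝ) R)
    (hq : ∀ᵐ r : ℝ, r ∈ Ioo (0 : ℝ) r₁ →
      -(((n : ℝ) * ((n : ℝ) - 4 + 2 * α) / 4 + (l : ℝ) * ((l : ℝ) + (n : ℝ) - 2)) *
          r ^ (α - 2)) ≤ q r) :
    NonoscillatoryAtZero R α
      (fun r : ℝ =>
        (((n : ℝ) - 1) * ((n : ℝ) - 3 + 2 * α) / 4 + (l : ℝ) * ((l : ℝ) + (n : ℝ) - 2)) *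
            r ^ (α - 2) + q r) ∧
    LimitPointAtZero R α
      (fun r : ℝ =>
        (((n : ℝ) - 1) * ((n : ℝ) - 3 + 2 * α) / 4 + (l : ℝ) * ((l : ℝ) + (n : ℝ) - 2)) *
            r ^ (α - 2) + q r) := by
  set Q : ℝ → ℝ := fun r : ℝ =>
    (((n : ℝ) - 1) * ((n : ℝ) - 3 + 2 * α) / 4 + (l : ℝ) * ((l : ℝ) + (n : ℝ) - 2)) *
      r ^ (α - 2) + q r with hQdef
  have hQ : ∀ x ∈ Ioo 0 R, ∀ y ∈ Ioo 0 R, IntervalIntegrable Q volume x y := by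
    intro x hx y hy
    refine ((intervalIntegrable_rpow_of_mem_Ioo (α - 2) x hx y hy).const_mul _).add ?_
    exact (hq_loc.integrableOn_compact_subset
      (OrdConnected.uIcc_subset inferInstance hx hy) isCompact_uIcc).intervalIntegrable
  have hle : ∀ᵐ x : ℝ, x ∈ Ioo 0 r₁ → (3 - 2 * α) / 4 * x ^ (α - 2) ≤ Q x := by
    filter_upwards [hq] with x hx hxr
    have := hx hxr
    rw [hQdef]
    linarith
  obtain ⟨u, v, hu, hv, c, hc, hge⟩ := exists_solution_ge_rpow hQ hr₁ hle
  exact ⟨nonoscillatoryAtZero_of_solution_ge hu hv hc hge,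
    limitPointAtZero_of_solution_ge hQ hu hv hc hge⟩
end
end

section
/- Let n ∈ ℕ with n ≥ 2, ℓ ∈ ℕ₀, α ∈ (−∞,2), R ∈ (0,∞), and let q : (0,R) → ℝ be measurable and locally integrable. Consider on (0,R) the differential expression τ_{n,ℓ,α} = −(d/dr) r^α (d/dr) + [ (n−1)(n−3+2α)/4 + ℓ(ℓ+n−2) ]·r^(α−2) + q(r). Suppose there exist N ∈ ℕ, ε > 0, and r₁ ∈ (0,R) such that the iterated logarithms ln₁(r),…,ln_N(r) are defined and positive on (0,r₁) and, for a.e. r ∈ (0,r₁), q(r) ≥ −[ n(n−4+2α)/4 + ℓ(ℓ+n−2) ]·r^(α−2) − (1/2)(2 − α)·r^(α−2)·Σ_{j=1}^{N} Π_{m=1}^{j} [ln_m(r)]^(−1) + (3/4 + ε)·r^(α−2)·[ln₁(r)]^(−2). Then τ_{n,ℓ,α} is nonoscillatory at r = 0 and in the limit point case at r = 0. -/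
noncomputable section

open MeasureTheory Set
open scoped ENNReal NNReal

open Filter Topology

/-- Iterates of the Volterra operator attached to the off-diagonal linear system with
coefficients `a i`, started at the constant `y₀`. -/
def volterraIter (a : Bool → ℝ → ℂ) (c : ℝ) (y₀ : Bool → ℂ) : ℕ → Bool → ℝ → ℂ
  | 0, i, _ => y₀ i
  | n + 1, i, x => ∫ t in c..x, a i t * volterraIter a c y₀ n (!i) t

theorem integral_mul_primitive_pow {m : ℝ → ℝ} {c x : ℝ}
    (hm : IntervalIntegrable m volume c x) (n : ℕ) :
    ∫ t in c..x, m t * (∫ s in c..t, m s) ^ n = (∫ s in c..x, m s) ^ (n + 1) / (n + 1) := by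
  set G : ℝ → ℝ := fun t => ∫ s in c..t, m s with hG
  have hGac : AbsolutelyContinuousOnInterval G c x :=
    hm.absolutelyContinuousOnInterval_intervalIntegral left_mem_uIcc
  have hpow : ∀ k : ℕ, AbsolutelyContinuousOnInterval (fun t => G t ^ (k + 1)) c x := by
    intro k
    induction k with
    | zero => simpa using hGac
    | succ k ih => simpa only [pow_succ _ (k + 1)] using ih.fun_mul hGac
  have h := (hpow n).integral_deriv_eq_sub
  have h0 : G c = 0 := by simp [hG]
  rw [h0, zero_pow (Nat.succ_ne_zero n), sub_zero] at h
  rw [eq_div_iff (by positivity), mul_comm, ← intervalIntegral.integral_const_mul, ← h]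
  apply intervalIntegral.integral_congr_ae
  filter_upwards [hm.ae_hasDerivAt_integral] with t ht hmem
  have := ((ht (uIoc_subset_uIcc hmem) c left_mem_uIcc).pow (n + 1)).deriv
  simp only [Pi.pow_def] at this
  rw [this]
  simp
  ring

theorem abs_integral_mul_abs_primitive_pow {m : ℝ → ℝ} {c x : ℝ} (hm0 : ∀ t, 0 ≤ m t)
    (hm : IntervalIntegrable m volume c x) (n : ℕ) :
    |∫ t in c..x, m t * |∫ s in c..t, m s| ^ n| = |∫ s in c..x, m s| ^ (n + 1) / (n + 1) := by
  have key : |∫ t in c..x, m t * |∫ s in c..t, m s| ^ n|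
      = |∫ t in c..x, m t * (∫ s in c..t, m s) ^ n| := by
    rcases le_total c x with h | h
    · congr 1
      apply intervalIntegral.integral_congr
      intro t ht
      rw [uIcc_of_le h] at ht
      simp only
      rw [abs_of_nonneg (intervalIntegral.integral_nonneg ht.1 fun s _ => hm0 s)]
    · have : ∫ t in c..x, m t * |∫ s in c..t, m s| ^ n
          = ∫ t in c..x, (-1) ^ n * (m t * (∫ s in c..t, m s) ^ n) := by
        apply intervalIntegral.integral_congr
        intro t ht
        rw [uIcc_of_ge h] at ht
        have hneg : ∫ s in c..t, m s ≤ 0 := by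
          rw [intervalIntegral.integral_symm]
          exact neg_nonpos.2 (intervalIntegral.integral_nonneg ht.2 fun s _ => hm0 s)
        simp only
        rw [abs_of_nonpos hneg, neg_pow]
        ring
      rw [this, intervalIntegral.integral_const_mul, abs_mul]
      simp
  rw [key, integral_mul_primitive_pow hm, abs_div, abs_pow]
  congr 1
  exact abs_of_nonneg (by positivity)

theorem continuousOn_primitive_Ioo {E : Type*} [NormedAddCommGroup E] [NormedSpace ℝ E]
    {p q c : ℝ} {f : ℝ → E}
    (hf : ∀ x ∈ Ioo p q, ∀ y ∈ Ioo p q, IntervalIntegrable f volume x y) (hc : c ∈ Ioo p q) :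
    ContinuousOn (fun x => ∫ t in c..x, f t) (Ioo p q) := by
  intro x hx
  obtain ⟨r, hr⟩ := exists_between (lt_min hx.1 hc.1)
  obtain ⟨s, hs⟩ := exists_between (max_lt hx.2 hc.2)
  have hrx : r < x := hr.2.trans_le (min_le_left _ _)
  have hrc : r < c := hr.2.trans_le (min_le_right _ _)
  have hxs : x < s := (le_max_left _ _).trans_lt hs.1
  have hcs : c < s := (le_max_right _ _).trans_lt hs.1
  have := intervalIntegral.continuousOn_primitive_interval'
    (hf r ⟨hr.1, hrx.trans hx.2⟩ s ⟨hx.1.trans hxs, hs.2⟩)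
    (a := c) (by rw [uIcc_of_le (by linarith)]; exact ⟨hrc.le, hcs.le⟩)
  rw [uIcc_of_le (by linarith)] at this
  exact (this.continuousAt (Icc_mem_nhds hrx hxs)).continuousWithinAt

/-- Existence for an off-diagonal linear system with locally integrable coefficients. -/
theorem exists_continuousOn_integral_eq {p q c : ℝ} (a : Bool → ℝ → ℂ)
    (ha : ∀ i, ∀ x ∈ Ioo p q, ∀ y ∈ Ioo p q, IntervalIntegrable (a i) volume x y)
    (hc : c ∈ Ioo p q) (y₀ : Bool → ℂ) :
    ∃ y : Bool → ℝ → ℂ, (∀ i, ContinuousOn (y i) (Ioo p q)) ∧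
      ∀ i, ∀ x ∈ Ioo p q, y i x = y₀ i + ∫ t in c..x, a i t * y (!i) t := by
  set Y := volterraIter a c y₀ with hY
  set m : ℝ → ℝ := fun t => ‖a true t‖ + ‖a false t‖ with hm
  set G : ℝ → ℝ := fun t => ∫ s in c..t, m s with hG
  set C : ℝ := ‖y₀ true‖ + ‖y₀ false‖ with hC
  have hC0 : 0 ≤ C := by positivity
  have hm0 : ∀ t, 0 ≤ m t := fun t => by positivity
  have ham : ∀ i t, ‖a i t‖ ≤ m t := by
    intro i t
    cases i <;> simp [hm]
  have hsub : ∀ {x y}, x ∈ Ioo p q → y ∈ Ioo p q → uIcc x y ⊆ Ioo p q :=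
    fun hx hy => ordConnected_Ioo.uIcc_subset hx hy
  have hmi : ∀ x ∈ Ioo p q, ∀ y ∈ Ioo p q, IntervalIntegrable m volume x y :=
    fun x hx y hy => (ha true x hx y hy).norm.add (ha false x hx y hy).norm
  have hGcont : ContinuousOn G (Ioo p q) := continuousOn_primitive_Ioo hmi hc
  have hYmain : ∀ n i, ContinuousOn (Y n i) (Ioo p q) ∧
      ∀ x ∈ Ioo p q, ‖Y n i x‖ ≤ C * (|G x| ^ n / n.factorial) := by
    intro n
    induction n with
    | zero =>
      intro i
      refine ⟨continuousOn_const, fun x _ => ?_⟩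
      cases i <;> simp [hY, volterraIter, hC]
    | succ n ih =>
      intro i
      refine ⟨continuousOn_primitive_Ioo (fun x hx y hy =>
        (ha i x hx y hy).mul_continuousOn ((ih (!i)).1.mono (hsub hx hy))) hc, fun x hx => ?_⟩
      have hGc : ContinuousOn G (uIcc c x) := hGcont.mono (hsub hc hx)
      calc ‖∫ t in c..x, a i t * Y n (!i) t‖
          ≤ |∫ t in c..x, C / n.factorial * (m t * |G t| ^ n)| := by
            apply intervalIntegral.norm_integral_le_abs_of_norm_le
            · refine (ae_restrict_iff' measurableSet_uIoc).2 (.of_forall fun t ht => ?_)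
              have h1 := (ih (!i)).2 t (hsub hc hx (uIoc_subset_uIcc ht))
              rw [norm_mul]
              calc _ ≤ m t * (C * (|G t| ^ n / n.factorial)) := by
                    exact mul_le_mul (ham i t) h1 (norm_nonneg _) (hm0 t)
                _ = _ := by ring
            · exact ((hmi c hc x hx).mul_continuousOn (hGc.abs.pow n)).const_mul _
        _ = C * (|G x| ^ (n + 1) / (n + 1).factorial) := by
            rw [intervalIntegral.integral_const_mul, abs_mul, hG,
              abs_integral_mul_abs_primitive_pow hm0 (hmi c hc x hx),
              abs_of_nonneg (by positivity), Nat.factorial_succ]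
            push_cast
            field_simp
  have hbd : ∀ r ∈ Ioo p q, ∀ s ∈ Ioo p q, ∃ K : ℝ, ∀ n i, ∀ t ∈ uIcc r s,
      ‖Y n i t‖ ≤ C * (K ^ n / n.factorial) := by
    intro r hr s hs
    obtain ⟨K, hK⟩ := isCompact_uIcc.exists_bound_of_continuousOn (hGcont.mono (hsub hr hs))
    refine ⟨K, fun n i t ht => ((hYmain n i).2 t (hsub hr hs ht)).trans ?_⟩
    gcongr
    exact hK t ht
  have hsum : ∀ K : ℝ, Summable fun n : ℕ => C * (K ^ n / n.factorial) :=
    fun K => (Real.summable_pow_div_factorial K).mul_left C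
  refine ⟨fun i x => ∑' n, Y n i x, fun i x hx => ?_, fun i x hx => ?_⟩
  · obtain ⟨r, hr⟩ := exists_between hx.1
    obtain ⟨s, hs⟩ := exists_between hx.2
    have hrI : r ∈ Ioo p q := ⟨hr.1, hr.2.trans hx.2⟩
    have hsI : s ∈ Ioo p q := ⟨hx.1.trans hs.1, hs.2⟩
    obtain ⟨K, hK⟩ := hbd r hrI s hsI
    have hcont : ContinuousOn (fun x => ∑' n, Y n i x) (uIcc r s) :=
      continuousOn_tsum (fun n => (hYmain n i).1.mono (hsub hrI hsI)) (hsum K)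
        fun n t ht => hK n i t ht
    rw [uIcc_of_le (hr.2.trans hs.1).le] at hcont
    exact (hcont.continuousAt (Icc_mem_nhds hr.2 hs.1)).continuousWithinAt
  · obtain ⟨K, hK⟩ := hbd c hc x hx
    have hS : ∀ j, ∀ t ∈ uIcc c x, Summable fun n => Y n j t :=
      fun j t ht => .of_norm_bounded (hsum K) fun n => hK n j t ht
    have hint : HasSum (fun n => ∫ t in c..x, a i t * Y n (!i) t)
        (∫ t in c..x, a i t * ∑' n, Y n (!i) t) := by
      apply intervalIntegral.hasSum_integral_of_dominated_convergence
        (fun n t => m t * (C * (K ^ n / n.factorial)))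
      · intro n
        exact ((ha i c hc x hx).mul_continuousOn
          ((hYmain n (!i)).1.mono (hsub hc hx))).aestronglyMeasurable_restrict_uIoc
      · refine fun n => .of_forall fun t ht => ?_
        rw [norm_mul]
        exact mul_le_mul (ham i t) (hK n _ t (uIoc_subset_uIcc ht)) (norm_nonneg _) (hm0 t)
      · exact .of_forall fun t _ => (hsum K).mul_left _
      · simp_rw [tsum_mul_left]
        exact (hmi c hc x hx).mul_const _
      · exact .of_forall fun t ht => ((hS _ t (uIoc_subset_uIcc ht)).hasSum).mul_left _
    have := (hS i x right_mem_uIcc).tsum_eq_zero_add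
    simp only
    rw [this, ← hint.tsum_eq]
    rfl

theorem AbsolutelyContinuousOnInterval.le_of_ae_hasDerivAt_nonneg {f : ℝ → ℝ} {a b : ℝ}
    (hab : a ≤ b) (hf : AbsolutelyContinuousOnInterval f a b)
    (h : ∀ᵐ x, x ∈ Icc a b → ∃ d, 0 ≤ d ∧ HasDerivAt f d x) : f a ≤ f b := by
  rw [← sub_nonneg, ← hf.integral_deriv_eq_sub]
  refine intervalIntegral.integral_nonneg_of_ae_restrict hab ?_
  refine (ae_restrict_iff' measurableSet_Icc).2 (h.mono fun x hx hm => ?_)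
  obtain ⟨d, hd, hder⟩ := hx hm
  simpa [hder.deriv] using hd

theorem absolutelyContinuousOnInterval_of_eq_integral {f g : ℝ → ℝ} {x c : ℝ} (hxc : x ≤ c)
    (hg : IntervalIntegrable g volume x c)
    (hf : ∀ t ∈ Icc x c, f t = f c + ∫ s in c..t, g s) :
    AbsolutelyContinuousOnInterval f x c ∧ ∀ᵐ t, t ∈ Ioo x c → HasDerivAt f (g t) t := by
  have hcm : c ∈ uIcc x c := right_mem_uIcc
  constructor
  · have h1 := hg.absolutelyContinuousOnInterval_intervalIntegral hcm
    have h2 : AbsolutelyContinuousOnInterval (fun _ : ℝ => f c) x c :=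
      contDiffOn_const.absolutelyContinuousOnInterval
    have h3 := h2.fun_add h1
    rw [absolutelyContinuousOnInterval_iff] at h3 ⊢
    intro ε hε
    obtain ⟨δ, hδ, H⟩ := h3 ε hε
    refine ⟨δ, hδ, fun E hE hlt => ?_⟩
    have := H E hE hlt
    rw [uIcc_of_le hxc] at *
    refine lt_of_eq_of_lt (Finset.sum_congr rfl fun i hi => ?_) this
    have hm := hE.1 i hi
    rw [uIcc_of_le hxc] at hm
    rw [hf _ hm.1, hf _ hm.2]
  · filter_upwards [hg.ae_hasDerivAt_integral] with t ht hm
    have h1 := (ht (by rw [uIcc_of_le hxc]; exact ⟨hm.1.le, hm.2.le⟩) c hcm).const_add (f c)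
    refine h1.congr_of_eventuallyEq ?_
    filter_upwards [Icc_mem_nhds hm.1 hm.2] with s hs
    exact hf s hs

/-- Sturm-type comparison for complex solutions, written in real and imaginary parts: `θ` solves
a Riccati inequality and `D` plays the role of the inverse square of the comparison function. -/
theorem le_normSq_mul_of_riccati_le {c α a b : ℝ} {Q u₁ u₂ v₁ v₂ D θ θ' : ℝ → ℝ}
    (hQ : ∀ x ∈ Ioc 0 c, IntervalIntegrable Q volume x c)
    (hu₁c : ContinuousOn u₁ (Ioc 0 c)) (hu₂c : ContinuousOn u₂ (Ioc 0 c))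
    (hv₁c : ContinuousOn v₁ (Ioc 0 c)) (hv₂c : ContinuousOn v₂ (Ioc 0 c))
    (hu₁ : ∀ x ∈ Ioc 0 c, u₁ x = u₁ c + ∫ t in c..x, t ^ (-α) * v₁ t)
    (hu₂ : ∀ x ∈ Ioc 0 c, u₂ x = u₂ c + ∫ t in c..x, t ^ (-α) * v₂ t)
    (hv₁ : ∀ x ∈ Ioc 0 c, v₁ x = v₁ c + ∫ t in c..x, ((Q t - a) * u₁ t + b * u₂ t))
    (hv₂ : ∀ x ∈ Ioc 0 c, v₂ x = v₂ c + ∫ t in c..x, ((Q t - a) * u₂ t - b * u₁ t))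
    (hu₁0 : u₁ c = 1) (hu₂0 : u₂ c = 0) (hv₁0 : v₁ c = θ c)
    (hDs : ∀ x ∈ Ioc 0 c, ContDiffAt ℝ 1 D x) (hθs : ∀ x ∈ Ioc 0 c, ContDiffAt ℝ 1 θ x)
    (hD : ∀ x ∈ Ioo 0 c, HasDerivAt D (-2 * x ^ (-α) * θ x * D x) x)
    (hD0 : ∀ x ∈ Ioc 0 c, 0 ≤ D x)
    (hθ : ∀ x ∈ Ioo 0 c, HasDerivAt θ (θ' x) x)
    (hle : ∀ᵐ x, x ∈ Ioo 0 c → θ' x + x ^ (-α) * θ x ^ 2 ≤ Q x - a) :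
    ∀ x ∈ Ioc 0 c, D c ≤ (u₁ x ^ 2 + u₂ x ^ 2) * D x := by
  have hsub : ∀ {x}, x ∈ Ioc 0 c → Icc x c ⊆ Ioc 0 c := fun hx t ht => ⟨hx.1.trans_le ht.1, ht.2⟩
  have hpow : ∀ {x}, x ∈ Ioc 0 c → ContinuousOn (fun t : ℝ => t ^ (-α)) (uIcc x c) := by
    intro x hx t ht
    rw [uIcc_of_le hx.2] at ht
    exact (Real.continuousAt_rpow_const _ _ (.inl (hx.1.trans_le ht.1).ne')).continuousWithinAt
  have hmono : ∀ {f : ℝ → ℝ}, ContinuousOn f (Ioc 0 c) → ∀ {x}, x ∈ Ioc 0 c →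
      ContinuousOn f (uIcc x c) := by
    intro f hf x hx
    rw [uIcc_of_le hx.2]
    exact hf.mono (hsub hx)
  have hac : ∀ x ∈ Ioc 0 c,
      (AbsolutelyContinuousOnInterval u₁ x c ∧
        ∀ᵐ t, t ∈ Ioo x c → HasDerivAt u₁ (t ^ (-α) * v₁ t) t) ∧
      (AbsolutelyContinuousOnInterval u₂ x c ∧
        ∀ᵐ t, t ∈ Ioo x c → HasDerivAt u₂ (t ^ (-α) * v₂ t) t) ∧
      (AbsolutelyContinuousOnInterval v₁ x c ∧
        ∀ᵐ t, t ∈ Ioo x c → HasDerivAt v₁ ((Q t - a) * u₁ t + b * u₂ t) t) ∧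
      (AbsolutelyContinuousOnInterval v₂ x c ∧
        ∀ᵐ t, t ∈ Ioo x c → HasDerivAt v₂ ((Q t - a) * u₂ t - b * u₁ t) t) ∧
      AbsolutelyContinuousOnInterval D x c ∧ AbsolutelyContinuousOnInterval θ x c := by
    intro x hx
    have hQa : IntervalIntegrable (fun t => Q t - a) volume x c :=
      (hQ x hx).sub intervalIntegrable_const
    refine ⟨?_, ?_, ?_, ?_, ?_, ?_⟩
    · exact absolutelyContinuousOnInterval_of_eq_integral hx.2
        ((hpow hx).mul (hmono hv₁c hx)).intervalIntegrable fun t ht => hu₁ t (hsub hx ht)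
    · exact absolutelyContinuousOnInterval_of_eq_integral hx.2
        ((hpow hx).mul (hmono hv₂c hx)).intervalIntegrable fun t ht => hu₂ t (hsub hx ht)
    · exact absolutelyContinuousOnInterval_of_eq_integral hx.2
        ((hQa.mul_continuousOn (hmono hu₁c hx)).add
          ((hmono hu₂c hx).intervalIntegrable.const_mul b)) fun t ht => hv₁ t (hsub hx ht)
    · exact absolutelyContinuousOnInterval_of_eq_integral hx.2
        ((hQa.mul_continuousOn (hmono hu₂c hx)).sub
          ((hmono hu₁c hx).intervalIntegrable.const_mul b)) fun t ht => hv₂ t (hsub hx ht)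
    · refine ContDiffOn.absolutelyContinuousOnInterval fun t ht => ?_
      rw [uIcc_of_le hx.2] at ht
      exact (hDs t (hsub hx ht)).contDiffWithinAt
    · refine ContDiffOn.absolutelyContinuousOnInterval fun t ht => ?_
      rw [uIcc_of_le hx.2] at ht
      exact (hθs t (hsub hx ht)).contDiffWithinAt
  have hne : ∀ d : ℝ, ∀ᵐ x : ℝ, x ≠ d := fun d => by simp [ae_iff, measure_singleton]
  set k : ℝ → ℝ := fun x => (u₁ x * v₁ x + u₂ x * v₂ x) - θ x * (u₁ x * u₁ x + u₂ x * u₂ x) with hk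
  have hkc : k c = 0 := by simp [hk, hu₁0, hu₂0, hv₁0]
  have hk0 : ∀ x ∈ Ioc 0 c, k x ≤ 0 := by
    intro x hx
    obtain ⟨⟨a1, d1⟩, ⟨a2, d2⟩, ⟨a3, d3⟩, ⟨a4, d4⟩, -, a6⟩ := hac x hx
    rw [← hkc]
    refine AbsolutelyContinuousOnInterval.le_of_ae_hasDerivAt_nonneg hx.2
      (((a1.fun_mul a3).fun_add (a2.fun_mul a4)).fun_sub
        (a6.fun_mul ((a1.fun_mul a1).fun_add (a2.fun_mul a2)))) ?_
    filter_upwards [d1, d2, d3, d4, hle, hne x, hne c] with t e1 e2 e3 e4 hle' n1 n2 ht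
    have ht' : t ∈ Ioo x c := ⟨lt_of_le_of_ne ht.1 n1.symm, lt_of_le_of_ne ht.2 n2⟩
    have ht0 : t ∈ Ioo 0 c := ⟨hx.1.trans ht'.1, ht'.2⟩
    refine ⟨_, ?_, (((e1 ht').mul (e3 ht')).add ((e2 ht').mul (e4 ht'))).sub
      ((hθ t ht0).mul (((e1 ht').mul (e1 ht')).add ((e2 ht').mul (e2 ht'))))⟩
    have hp : 0 ≤ t ^ (-α) := Real.rpow_nonneg ht0.1.le _
    have h1 := hle' ht0
    have e : 0 ≤ t ^ (-α) * ((v₁ t - θ t * u₁ t) ^ 2 + (v₂ t - θ t * u₂ t) ^ 2) +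
      (Q t - a - (θ' t + t ^ (-α) * θ t ^ 2)) * (u₁ t ^ 2 + u₂ t ^ 2) :=
      add_nonneg (by positivity) (mul_nonneg (by linarith) (by positivity))
    linarith [e]
  intro x hx
  obtain ⟨⟨a1, d1⟩, ⟨a2, d2⟩, -, -, a5, -⟩ := hac x hx
  have := AbsolutelyContinuousOnInterval.le_of_ae_hasDerivAt_nonneg hx.2
      (((a1.fun_mul a1).fun_add (a2.fun_mul a2)).fun_mul a5).fun_neg ?_
  · simp only [hu₁0, hu₂0] at this
    linarith [this]
  · filter_upwards [d1, d2, hne x, hne c] with t e1 e2 n1 n2 ht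
    have ht' : t ∈ Ioo x c := ⟨lt_of_le_of_ne ht.1 n1.symm, lt_of_le_of_ne ht.2 n2⟩
    have ht0 : t ∈ Ioo 0 c := ⟨hx.1.trans ht'.1, ht'.2⟩
    refine ⟨_, ?_,
      ((((e1 ht').mul (e1 ht')).add ((e2 ht').mul (e2 ht'))).mul (hD t ht0)).neg⟩
    have hp : 0 ≤ t ^ (-α) := Real.rpow_nonneg ht0.1.le _
    have h1 := hk0 t ⟨ht0.1, ht0.2.le⟩
    have h2 := hD0 t ⟨ht0.1, ht0.2.le⟩
    simp only [Pi.add_apply, Pi.mul_apply]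
    have e : 0 ≤ 2 * (t ^ (-α) * D t * (-k t)) := by
      have : 0 ≤ -k t := by linarith
      positivity
    simp only [hk] at e
    linarith [e]

theorem tendsto_iterLog_atTop (j : ℕ) : Tendsto (iterLog j) (𝓝[>] 0) atTop := by
  induction j with
  | zero => simpa [iterLog, one_div] using tendsto_inv_nhdsGT_zero (𝕜 := ℝ)
  | succ j ih => exact Real.tendsto_log_atTop.comp ih

/-- The product of the reciprocals of the first `j` iterated logarithms. -/
def invLogProd (j : ℕ) (x : ℝ) : ℝ := ∏ m ∈ Finset.Icc 1 j, (iterLog m x)⁻¹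

/-- The sum of the first `N` products of reciprocals of iterated logarithms. -/
def invLogSum (N : ℕ) (x : ℝ) : ℝ := ∑ j ∈ Finset.Icc 1 N, invLogProd j x

theorem invLogProd_succ (j : ℕ) (x : ℝ) :
    invLogProd (j + 1) x = invLogProd j x * (iterLog (j + 1) x)⁻¹ :=
  Finset.prod_Icc_succ_top (by omega) _

theorem invLogSum_succ (j : ℕ) (x : ℝ) :
    invLogSum (j + 1) x = invLogSum j x + invLogProd (j + 1) x :=
  Finset.sum_Icc_succ_top (by omega) _

theorem invLogProd_pos {N : ℕ} {x : ℝ} (h : ∀ j ≤ N, 0 < iterLog j x) : 0 < invLogProd N x :=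
  Finset.prod_pos fun m hm => inv_pos.2 (h m (Finset.mem_Icc.1 hm).2)

theorem hasDerivAt_iterLog_succ {x : ℝ} {N : ℕ} (h : ∀ j ≤ N, 0 < iterLog j x) :
    HasDerivAt (iterLog (N + 1)) (-(invLogProd N x / x)) x := by
  induction N with
  | zero =>
    have hx : x ≠ 0 := by
      rintro rfl
      simpa [iterLog] using h 0 le_rfl
    have : iterLog 1 = fun y => -Real.log y := by
      ext y
      simp [iterLog]
    simpa [this, invLogProd] using! (Real.hasDerivAt_log hx).neg
  | succ N ih =>
    have := (ih fun j hj => h j (by omega)).log (h (N + 1) le_rfl).ne'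
    convert! this using 1
    rw [invLogProd_succ]
    ring

theorem contDiffAt_iterLog {x : ℝ} {N : ℕ} (h : ∀ j ≤ N, 0 < iterLog j x) :
    ContDiffAt ℝ 1 (iterLog N) x := by
  induction N with
  | zero =>
    have hx : x ≠ 0 := by
      rintro rfl
      simpa [iterLog] using h 0 le_rfl
    exact contDiffAt_const.div contDiffAt_id hx
  | succ N ih => exact (ih fun j hj => h j (by omega)).log (h N (by omega)).ne'

theorem contDiffAt_invLogProd {x : ℝ} {N : ℕ} (h : ∀ j ≤ N, 0 < iterLog j x) :
    ContDiffAt ℝ 1 (invLogProd N) x :=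
  contDiffAt_prod fun m hm =>
    (contDiffAt_iterLog fun j hj => h j (hj.trans (Finset.mem_Icc.1 hm).2)).inv
      (h m (Finset.mem_Icc.1 hm).2).ne'

theorem contDiffAt_invLogSum {x : ℝ} {N : ℕ} (h : ∀ j ≤ N, 0 < iterLog j x) :
    ContDiffAt ℝ 1 (invLogSum N) x :=
  ContDiffAt.sum fun _ hm =>
    contDiffAt_invLogProd fun j hj => h j (hj.trans (Finset.mem_Icc.1 hm).2)

theorem hasDerivAt_invLogProd {x : ℝ} {N : ℕ} (h : ∀ j ≤ N, 0 < iterLog j x) :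
    HasDerivAt (invLogProd N) (invLogProd N x * invLogSum N x / x) x := by
  induction N with
  | zero => simpa [invLogProd, invLogSum] using! hasDerivAt_const x (1 : ℝ)
  | succ N ih =>
    have h' : ∀ j ≤ N, 0 < iterLog j x := fun j hj => h j (by omega)
    have hpos := h (N + 1) le_rfl
    have := (ih h').mul ((hasDerivAt_iterLog_succ h').inv hpos.ne')
    have e : invLogProd (N + 1) = invLogProd N * (iterLog (N + 1))⁻¹ := by
      ext y
      simp [invLogProd_succ]
    rw [e]
    convert! this using 1
    simp only [Pi.mul_apply, Pi.inv_apply, invLogSum_succ, invLogProd_succ]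
    field_simp

theorem hasDerivAt_invLogSum {x : ℝ} {N : ℕ} (h : ∀ j ≤ N, 0 < iterLog j x) :
    HasDerivAt (invLogSum N)
      ((∑ j ∈ Finset.Icc 1 N, invLogProd j x * invLogSum j x) / x) x := by
  rw [Finset.sum_div]
  exact HasDerivAt.fun_sum fun m hm =>
    hasDerivAt_invLogProd fun j hj => h j (hj.trans (Finset.mem_Icc.1 hm).2)

theorem eventually_iterLog_pos (N : ℕ) : ∀ᶠ x in 𝓝[>] (0 : ℝ), ∀ j ≤ N, 0 < iterLog j x := by
  have : ∀ᶠ x in 𝓝[>] (0 : ℝ), ∀ j ∈ Finset.range (N + 1), 0 < iterLog j x :=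
    (Finset.eventually_all _).2 fun j _ => (tendsto_iterLog_atTop j).eventually_gt_atTop 0
  filter_upwards [this] with x hx j hj
  exact hx j (Finset.mem_range.2 (by omega))

theorem tendsto_iterLog_one_mul_invLogProd (j : ℕ) :
    Tendsto (fun x => iterLog 1 x * invLogProd (j + 1) x) (𝓝[>] 0)
      (𝓝 (if j = 0 then 1 else 0)) := by
  induction j with
  | zero =>
    refine tendsto_const_nhds.congr' ?_
    filter_upwards [(tendsto_iterLog_atTop 1).eventually_gt_atTop 0] with x hx
    simp [invLogProd, hx.ne']
  | succ j ih =>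
    have := ih.mul (tendsto_iterLog_atTop (j + 2)).inv_tendsto_atTop
    simp only [mul_zero] at this
    simp only [Nat.succ_ne_zero, if_false]
    refine this.congr fun x => ?_
    rw [invLogProd_succ (j + 1), mul_assoc]
    rfl

theorem tendsto_iterLog_one_mul_invLogSum (N : ℕ) :
    Tendsto (fun x => iterLog 1 x * invLogSum (N + 1) x) (𝓝[>] 0) (𝓝 1) := by
  induction N with
  | zero => simpa [invLogSum] using! tendsto_iterLog_one_mul_invLogProd 0
  | succ N ih =>
    have := ih.add (tendsto_iterLog_one_mul_invLogProd (N + 1))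
    simp only [Nat.succ_ne_zero, if_false, add_zero] at this
    refine this.congr fun x => ?_
    rw [invLogSum_succ (N + 1), mul_add]

theorem tendsto_iterLog_one_sq_mul_sum (N : ℕ) :
    Tendsto (fun x => iterLog 1 x ^ 2 *
      ∑ j ∈ Finset.Icc 1 (N + 1), invLogProd j x * invLogSum j x) (𝓝[>] 0) (𝓝 1) := by
  induction N with
  | zero =>
    have := (tendsto_iterLog_one_mul_invLogProd 0).mul (tendsto_iterLog_one_mul_invLogSum 0)
    simp only [if_true, mul_one] at this
    refine this.congr fun x => ?_
    simp
    ring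
  | succ N ih =>
    have := ih.add ((tendsto_iterLog_one_mul_invLogProd (N + 1)).mul
      (tendsto_iterLog_one_mul_invLogSum (N + 1)))
    simp only [Nat.succ_ne_zero, if_false, add_zero, zero_mul] at this
    refine this.congr fun x => ?_
    rw [Finset.sum_Icc_succ_top (b := N + 1) (by omega)]
    ring

theorem tendsto_iterLog_one_sq_mul_rpow {s : ℝ} (hs : 0 < s) :
    Tendsto (fun x => iterLog 1 x ^ 2 * x ^ s) (𝓝[>] 0) (𝓝 0) := by
  have := (tendsto_log_mul_rpow_nhdsGT_zero (half_pos hs)).pow 2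
  rw [zero_pow two_ne_zero] at this
  refine this.congr' ?_
  filter_upwards [self_mem_nhdsWithin] with x (hx : 0 < x)
  rw [mul_pow, ← Real.rpow_natCast (x ^ (s / 2)), ← Real.rpow_mul hx.le]
  simp [iterLog]

/-- The remainder of the iterated-logarithm Riccati function is eventually dominated by
`(3 / 4 + ε) / ln₁ ^ 2`, with room for a bounded spectral shift. -/
theorem eventually_riccati_remainder_le {α ε : ℝ} (hα : α < 2) (hε : 0 < ε) (a : ℝ) (N : ℕ) :
    ∀ᶠ x in 𝓝[>] (0 : ℝ), invLogSum (N + 1) x ^ 2 / 4 +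
      (∑ j ∈ Finset.Icc 1 (N + 1), invLogProd j x * invLogSum j x) / 2 + a * x ^ (2 - α) ≤
      (3 / 4 + ε) * (iterLog 1 x)⁻¹ ^ 2 := by
  have h := ((((tendsto_iterLog_one_mul_invLogSum N).pow 2).div_const 4).add
    ((tendsto_iterLog_one_sq_mul_sum N).div_const 2)).add
    ((tendsto_iterLog_one_sq_mul_rpow (sub_pos.2 hα)).const_mul a)
  have hlt : (1 : ℝ) ^ 2 / 4 + 1 / 2 + a * 0 < 3 / 4 + ε := by linarith
  filter_upwards [h.eventually_lt_const hlt,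
    (tendsto_iterLog_atTop 1).eventually_gt_atTop 0] with x hx hL
  rw [inv_pow, ← div_eq_mul_inv, le_div_iff₀ (by positivity)]
  linarith

theorem exists_isSolutionC {R α c : ℝ} {Q : ℝ → ℝ}
    (hQ : ∀ x ∈ Ioo 0 R, ∀ y ∈ Ioo 0 R, IntervalIntegrable Q volume x y)
    (hc : c ∈ Ioo 0 R) (z u₀ v₀ : ℂ) :
    ∃ u v : ℝ → ℂ, ContinuousOn u (Ioo 0 R) ∧ ContinuousOn v (Ioo 0 R) ∧ u c = u₀ ∧ v c = v₀ ∧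
      IsSolutionC R α Q z u v := by
  let A : Bool → ℝ → ℂ := fun i t => if i then ((t ^ (-α) : ℝ) : ℂ) else (Q t : ℂ) - z
  have hA : ∀ i, ∀ x ∈ Ioo 0 R, ∀ y ∈ Ioo 0 R, IntervalIntegrable (A i) volume x y := by
    intro i x hx y hy
    cases i
    · have hQC : IntervalIntegrable (fun t => (Q t : ℂ)) volume x y :=
        ⟨(hQ x hx y hy).1.ofReal, (hQ x hx y hy).2.ofReal⟩
      simpa [A] using hQC.sub intervalIntegrable_const
    · have : ContinuousOn (fun t : ℝ => ((t ^ (-α) : ℝ) : ℂ)) (uIcc x y) := by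
        refine Complex.continuous_ofReal.comp_continuousOn fun t ht => ?_
        have ht0 := (ordConnected_Ioo.uIcc_subset hx hy ht).1
        exact (Real.continuousAt_rpow_const _ _ (.inl ht0.ne')).continuousWithinAt
      simpa only [A, if_true] using this.intervalIntegrable
  obtain ⟨y, hy, hyeq⟩ := exists_continuousOn_integral_eq A hA hc
    (fun i => if i then u₀ else v₀)
  refine ⟨y true, y false, hy true, hy false, by simp [hyeq true c hc], by simp [hyeq false c hc],
    fun x hx x₀ hx₀ => ?_⟩
  have hsplit : ∀ i, y i x = y i x₀ + ∫ t in x₀..x, A i t * y (!i) t := by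
    intro i
    have hint : ∀ x ∈ Ioo 0 R, ∀ x' ∈ Ioo 0 R,
        IntervalIntegrable (fun t => A i t * y (!i) t) volume x x' := fun x hx x' hx' =>
      (hA i x hx x' hx').mul_continuousOn ((hy _).mono (ordConnected_Ioo.uIcc_subset hx hx'))
    rw [hyeq i x hx, hyeq i x₀ hx₀, add_assoc,
      intervalIntegral.integral_add_adjacent_intervals (hint c hc x₀ hx₀) (hint x₀ hx₀ x hx)]
  exact ⟨hsplit true, hsplit false⟩

/-- Under the logarithmic lower bound on the potential, every solution with suitable initial data
at some `c` dominates, up to a constant, the square root of the derivative of an iterated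
logarithm. -/
theorem exists_forall_isSolutionC_le_normSq {R α ε r₁ : ℝ} {Q : ℝ → ℝ} {N : ℕ} (hα : α < 2)
    (hQ : ∀ x ∈ Ioo 0 R, ∀ y ∈ Ioo 0 R, IntervalIntegrable Q volume x y)
    (hε : 0 < ε) (hr₁ : r₁ ∈ Ioo 0 R)
    (hle : ∀ᵐ r, r ∈ Ioo 0 r₁ → r ^ (α - 2) * ((3 - 2 * α) / 4
      - (2 - α) / 2 * invLogSum (N + 1) r + (3 / 4 + ε) * (iterLog 1 r)⁻¹ ^ 2) ≤ Q r) (z : ℂ) :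
    ∃ c ∈ Ioo 0 R, (∀ x ∈ Ioc 0 c, ∀ j ≤ N + 1, 0 < iterLog j x) ∧ ∃ θ₀ : ℝ, ∃ K > 0,
      ∀ u v : ℝ → ℂ, ContinuousOn u (Ioo 0 R) → ContinuousOn v (Ioo 0 R) → u c = 1 → v c = θ₀ →
      IsSolutionC R α Q z u v →
      ∀ x ∈ Ioc 0 c, K * (invLogProd (N + 1) x / x) ≤ ‖u x‖ ^ 2 := by
  obtain ⟨c, hc0 : 0 < c, hcS⟩ := (mem_nhdsGT_iff_exists_Ioc_subset).1
    (((eventually_iterLog_pos (N + 1)).and (eventually_riccati_remainder_le hα hε z.re N)).and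
      (Ioo_mem_nhdsGT hr₁.1))
  have hpos : ∀ x ∈ Ioc 0 c, ∀ j ≤ N + 1, 0 < iterLog j x := fun x hx => (hcS hx).1.1
  have hcr : c < r₁ := (hcS ⟨hc0, le_rfl⟩).2.2
  have hcR : c ∈ Ioo 0 R := ⟨hc0, hcr.trans hr₁.2⟩
  have hIR : Ioc 0 c ⊆ Ioo 0 R := fun x hx => ⟨hx.1, hx.2.trans_lt hcR.2⟩
  have hPpos : ∀ x ∈ Ioc 0 c, 0 < invLogProd (N + 1) x := fun x hx => invLogProd_pos (hpos x hx)
  set D : ℝ → ℝ := fun x => x / invLogProd (N + 1) x with hD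
  set θ : ℝ → ℝ := fun x => x ^ (α - 1) * ((invLogSum (N + 1) x - 1) / 2) with hθ
  refine ⟨c, hcR, hpos, θ c, D c, div_pos hc0 (hPpos c ⟨hc0, le_rfl⟩),
    fun u v hu hv huc hvc hsol x hx => ?_⟩
  have hpowC : ∀ x ∈ Ioo 0 R, ContinuousOn (fun t : ℝ => ((t ^ (-α) : ℝ) : ℂ)) (uIcc c x) := by
    refine fun x hx => Complex.continuous_ofReal.comp_continuousOn fun t ht => ?_
    have ht0 := (ordConnected_Ioo.uIcc_subset hcR hx ht).1
    exact (Real.continuousAt_rpow_const _ _ (.inl ht0.ne')).continuousWithinAt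
  have hiu : ∀ x ∈ Ioo 0 R,
      IntervalIntegrable (fun t : ℝ => ((t ^ (-α) : ℝ) : ℂ) * v t) volume c x := fun x hx =>
    ((hpowC x hx).mul (hv.mono (ordConnected_Ioo.uIcc_subset hcR hx))).intervalIntegrable
  have hiv : ∀ x ∈ Ioo 0 R,
      IntervalIntegrable (fun t : ℝ => ((Q t : ℂ) - z) * u t) volume c x := by
    intro x hx
    have hQC : IntervalIntegrable (fun t => (Q t : ℂ)) volume c x :=
      ⟨(hQ c hcR x hx).1.ofReal, (hQ c hcR x hx).2.ofReal⟩
    exact (hQC.sub intervalIntegrable_const).mul_continuousOn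
      (hu.mono (ordConnected_Ioo.uIcc_subset hcR hx))
  have key := le_normSq_mul_of_riccati_le (c := c) (α := α) (a := z.re) (b := z.im) (Q := Q)
    (u₁ := fun x => (u x).re) (u₂ := fun x => (u x).im) (v₁ := fun x => (v x).re)
    (v₂ := fun x => (v x).im) (D := D) (θ := θ)
    (θ' := fun x => (α - 1) * x ^ (α - 2) * ((invLogSum (N + 1) x - 1) / 2) +
      x ^ (α - 1) * ((∑ j ∈ Finset.Icc 1 (N + 1), invLogProd j x * invLogSum j x) / x / 2))
    (fun x hx => hQ x (hIR hx) c hcR)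
    (Complex.continuous_re.comp_continuousOn (hu.mono hIR))
    (Complex.continuous_im.comp_continuousOn (hu.mono hIR))
    (Complex.continuous_re.comp_continuousOn (hv.mono hIR))
    (Complex.continuous_im.comp_continuousOn (hv.mono hIR))
    (fun x hx => by
      have h := congrArg Complex.re (hsol x (hIR hx) c hcR).1
      rw [Complex.add_re, ← Complex.reCLM_apply (∫ _ in c..x, _),
        ← ContinuousLinearMap.intervalIntegral_comp_comm _ (hiu x (hIR hx))] at h
      simpa using h)
    (fun x hx => by
      have h := congrArg Complex.im (hsol x (hIR hx) c hcR).1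
      rw [Complex.add_im, ← Complex.imCLM_apply (∫ _ in c..x, _),
        ← ContinuousLinearMap.intervalIntegral_comp_comm _ (hiu x (hIR hx))] at h
      simpa using h)
    (fun x hx => by
      have h := congrArg Complex.re (hsol x (hIR hx) c hcR).2
      rw [Complex.add_re, ← Complex.reCLM_apply (∫ _ in c..x, _),
        ← ContinuousLinearMap.intervalIntegral_comp_comm _ (hiv x (hIR hx))] at h
      simpa using h)
    (fun x hx => by
      have h := congrArg Complex.im (hsol x (hIR hx) c hcR).2
      rw [Complex.add_im, ← Complex.imCLM_apply (∫ _ in c..x, _),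
        ← ContinuousLinearMap.intervalIntegral_comp_comm _ (hiv x (hIR hx))] at h
      simpa [sub_eq_add_neg] using h)
    (by simp [huc]) (by simp [huc]) (by simp [hvc])
    (fun x hx => contDiffAt_id.div (contDiffAt_invLogProd (hpos x hx)) (hPpos x hx).ne')
    (fun x hx => (Real.contDiffAt_rpow_const (.inl hx.1.ne')).mul
      (((contDiffAt_invLogSum (hpos x hx)).sub contDiffAt_const).div_const 2))
    (fun x hx => by
      have hx' : x ∈ Ioc 0 c := ⟨hx.1, hx.2.le⟩
      have hP := hPpos x hx'
      have h := (hasDerivAt_id x).div (hasDerivAt_invLogProd (hpos x hx')) hP.ne'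
      refine h.congr_deriv ?_
      have h1 : x ^ (-α) * x ^ (α - 1) = x⁻¹ := by
        rw [← Real.rpow_add hx.1, show -α + (α - 1) = -1 by ring, Real.rpow_neg_one]
      have hx0 := hx.1.ne'
      have h2 : -2 * x ^ (-α) * θ x * D x = -(x ^ (-α) * x ^ (α - 1)) *
          (invLogSum (N + 1) x - 1) * (x / invLogProd (N + 1) x) := by
        simp only [hθ, hD]
        ring
      rw [h2, h1]
      simp only [id]
      field_simp
      ring)
    (fun x hx => div_nonneg hx.1.le (hPpos x hx).le)
    (fun x hx => by
      have h := (Real.hasDerivAt_rpow_const (p := α - 1) (.inl hx.1.ne')).mul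
        (((hasDerivAt_invLogSum (hpos x ⟨hx.1, hx.2.le⟩)).sub_const 1).div_const 2)
      rw [show α - 1 - 1 = α - 2 by ring] at h
      exact h)
    (by
      filter_upwards [hle] with x hq hx
      have h1 := hq ⟨hx.1, hx.2.trans hcr⟩
      have h2 := (hcS ⟨hx.1, hx.2.le⟩).1.2
      set T := ∑ j ∈ Finset.Icc 1 (N + 1), invLogProd j x * invLogSum j x
      set S := invLogSum (N + 1) x
      have hp : 0 < x ^ (α - 2) := Real.rpow_pos_of_pos hx.1 _
      have e1 : x ^ (α - 1) = x ^ (α - 2) * x := by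
        rw [← Real.rpow_add_one hx.1.ne']
        congr 1
        ring
      have e2 : x ^ (-α) = (x ^ (α - 2))⁻¹ * (x ^ 2)⁻¹ := by
        rw [← Real.rpow_neg hx.1.le, ← Real.rpow_natCast, ← Real.rpow_neg hx.1.le,
          ← Real.rpow_add hx.1]
        congr 1
        push_cast
        ring
      have e3 : x ^ (2 - α) = (x ^ (α - 2))⁻¹ := by
        rw [← Real.rpow_neg hx.1.le]
        congr 1
        ring
      rw [e3] at h2
      have h3 := mul_le_mul_of_nonneg_left h2 hp.le
      have hx0 := hx.1.ne'
      have h4 : (α - 1) * x ^ (α - 2) * ((S - 1) / 2) + x ^ (α - 1) * (T / x / 2) +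
          x ^ (-α) * θ x ^ 2 = x ^ (α - 2) * ((3 - 2 * α) / 4 - (2 - α) / 2 * S +
            (S ^ 2 / 4 + T / 2)) := by
        simp only [hθ]
        rw [e1, e2]
        field_simp
        ring
      have h5 : x ^ (α - 2) * (z.re * (x ^ (α - 2))⁻¹) = z.re := by
        field_simp
      rw [h4]
      linarith)
    x hx
  have hP := hPpos x hx
  have hx0 := hx.1
  rw [← Complex.normSq_eq_norm_sq, Complex.normSq_apply]
  calc D c * (invLogProd (N + 1) x / x)
      ≤ ((u x).re ^ 2 + (u x).im ^ 2) * D x * (invLogProd (N + 1) x / x) := by gcongr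
    _ = _ := by
      simp only [hD]
      field_simp

theorem limitPointAtZero_and_nonoscillatoryAtZero {R α ε r₁ : ℝ} {Q : ℝ → ℝ} {N : ℕ} (hα : α < 2)
    (hQ : ∀ x ∈ Ioo 0 R, ∀ y ∈ Ioo 0 R, IntervalIntegrable Q volume x y)
    (hε : 0 < ε) (hr₁ : r₁ ∈ Ioo 0 R)
    (hle : ∀ᵐ r, r ∈ Ioo 0 r₁ → r ^ (α - 2) * ((3 - 2 * α) / 4
      - (2 - α) / 2 * invLogSum (N + 1) r + (3 / 4 + ε) * (iterLog 1 r)⁻¹ ^ 2) ≤ Q r) :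
    NonoscillatoryAtZero R α Q ∧ LimitPointAtZero R α Q := by
  constructor
  · obtain ⟨c, hc, hpos, θ₀, K, hK, H⟩ :=
      exists_forall_isSolutionC_le_normSq hα hQ hε hr₁ hle 0
    obtain ⟨u, v, hu, hv, huc, hvc, hsol⟩ := exists_isSolutionC (α := α) hQ hc 0 1 θ₀
    have hpowC : ∀ x ∈ Ioo 0 R, ∀ y ∈ Ioo 0 R,
        IntervalIntegrable (fun t : ℝ => ((t ^ (-α) : ℝ) : ℂ) * v t) volume x y := by
      refine fun x hx y hy => ((Complex.continuous_ofReal.comp_continuousOn fun t ht => ?_).mul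
        (hv.mono (ordConnected_Ioo.uIcc_subset hx hy))).intervalIntegrable
      have ht0 := (ordConnected_Ioo.uIcc_subset hx hy ht).1
      exact (Real.continuousAt_rpow_const _ _ (.inl ht0.ne')).continuousWithinAt
    have hQC : ∀ x ∈ Ioo 0 R, ∀ y ∈ Ioo 0 R,
        IntervalIntegrable (fun t : ℝ => ((Q t : ℂ) - 0) * u t) volume x y := by
      intro x hx y hy
      have hQC : IntervalIntegrable (fun t => (Q t : ℂ)) volume x y :=
        ⟨(hQ x hx y hy).1.ofReal, (hQ x hx y hy).2.ofReal⟩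
      exact (hQC.sub intervalIntegrable_const).mul_continuousOn
        (hu.mono (ordConnected_Ioo.uIcc_subset hx hy))
    have hsolR : IsSolutionR R α Q 0 (fun x => (u x).re) fun x => (v x).re := by
      refine fun x hx x₀ hx₀ => ⟨?_, ?_⟩
      · have h := congrArg Complex.re (hsol x hx x₀ hx₀).1
        rw [Complex.add_re, ← Complex.reCLM_apply (∫ _ in x₀..x, _),
          ← ContinuousLinearMap.intervalIntegral_comp_comm _ (hpowC x₀ hx₀ x hx)] at h
        simpa using h
      · have h := congrArg Complex.re (hsol x hx x₀ hx₀).2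
        rw [Complex.add_re, ← Complex.reCLM_apply (∫ _ in x₀..x, _),
          ← ContinuousLinearMap.intervalIntegral_comp_comm _ (hQC x₀ hx₀ x hx)] at h
        simpa using h
    have hsolC : IsSolutionC R α Q 0 (fun x => ((u x).re : ℂ)) fun x => ((v x).re : ℂ) := by
      refine fun x hx x₀ hx₀ => ⟨?_, ?_⟩
      · have h := congrArg (fun s : ℝ => (s : ℂ)) (hsolR x hx x₀ hx₀).1
        simpa [← intervalIntegral.integral_ofReal] using h
      · have h := congrArg (fun s : ℝ => (s : ℂ)) (hsolR x hx x₀ hx₀).2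
        simpa [← intervalIntegral.integral_ofReal] using h
    have hlow := H _ _
      (Complex.continuous_ofReal.comp_continuousOn (Complex.continuous_re.comp_continuousOn hu))
      (Complex.continuous_ofReal.comp_continuousOn (Complex.continuous_re.comp_continuousOn hv))
      (by simp [huc]) (by simp [hvc]) hsolC
    refine ⟨_, _, hsolR, fun h => ?_, c, hc, ?_⟩
    · have := (h c hc).1
      simp [huc] at this
    · convert Set.finite_empty
      refine Set.eq_empty_of_forall_notMem fun x ⟨hx, hx0⟩ => ?_
      have hx' : x ∈ Ioc 0 c := ⟨hx.1, hx.2.le⟩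
      have h1 := hlow x hx'
      have h2 : 0 < K * (invLogProd (N + 1) x / x) :=
        mul_pos hK (div_pos (invLogProd_pos (hpos x hx')) hx.1)
      simp only [Function.comp_apply, hx0, Complex.ofReal_zero, norm_zero] at h1
      linarith
  · intro z
    obtain ⟨c, hc, hpos, θ₀, K, hK, H⟩ :=
      exists_forall_isSolutionC_le_normSq hα hQ hε hr₁ hle z
    obtain ⟨u, v, hu, hv, huc, hvc, hsol⟩ := exists_isSolutionC (α := α) hQ hc z 1 θ₀
    refine ⟨u, v, hsol, c, hc, ?_⟩
    have hlow := H u v hu hv huc hvc hsol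
    have hmem : Ioo 0 c ∈ 𝓝[>] (0 : ℝ) := Ioo_mem_nhdsGT hc.1
    have hnot : ¬ IntegrableOn (fun x => ‖u x‖ ^ 2) (Ioo 0 c) := by
      refine not_integrableOn_of_tendsto_norm_atTop_of_deriv_isBigO_filter (f := iterLog (N + 2))
        (𝓝[>] (0 : ℝ)) hmem ?_ (tendsto_norm_atTop_atTop.comp (tendsto_iterLog_atTop _)) ?_
      · filter_upwards [hmem] with x hx
        exact (hasDerivAt_iterLog_succ (hpos x ⟨hx.1, hx.2.le⟩)).differentiableAt
      · refine Asymptotics.IsBigO.of_bound K⁻¹ ?_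
        filter_upwards [hmem] with x hx
        have hx' : x ∈ Ioc 0 c := ⟨hx.1, hx.2.le⟩
        have hP := invLogProd_pos (hpos x hx')
        rw [(hasDerivAt_iterLog_succ (hpos x hx')).deriv, norm_neg, norm_pow, norm_norm,
          Real.norm_of_nonneg (div_pos hP hx.1).le, inv_mul_eq_div, le_div_iff₀ hK, mul_comm]
        exact hlow x hx'
    by_contra hfin
    refine hnot ⟨?_, ?_⟩
    · refine ContinuousOn.aestronglyMeasurable ?_ measurableSet_Ioo
      exact (hu.mono fun x hx => ⟨hx.1, hx.2.trans hc.2⟩).norm.pow 2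
    · rw [HasFiniteIntegral]
      refine lt_of_le_of_lt (le_of_eq ?_) (lt_top_iff_ne_top.2 hfin)
      refine lintegral_congr fun x => ?_
      simp [enorm_pow]
      rfl

theorem statement11 (n : ℕ) (hn : 2 ≤ n) (l : ℕ) (α : ℝ) (hα : α < 2)
    (R : ℝ) (hR : 0 < R)
    (q : ℝ → ℝ) (hq_meas : Measurable q)
    (hq_loc : LocallyIntegrableOn q (Ioo (0 : ℝ) R))
    (N : ℕ) (hN : 1 ≤ N) (ε : ℝ) (hε : 0 < ε)
    (r₁ : ℝ) (hr₁ : r₁ ∈ Ioo (0 : ℝ) R)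
    (hpos : ∀ r ∈ Ioo (0 : ℝ) r₁, ∀ j ∈ Finset.Icc 1 N, 0 < iterLog j r)
    (hq : ∀ᵐ r : ℝ, r ∈ Ioo (0 : ℝ) r₁ →
      -(((n : ℝ) * ((n : ℝ) - 4 + 2 * α) / 4 + (l : ℝ) * ((l : ℝ) + (n : ℝ) - 2)) *
          r ^ (α - 2))
        - (1 / 2) * (2 - α) * r ^ (α - 2) *
            ∑ j ∈ Finset.Icc 1 N, ∏ m ∈ Finset.Icc 1 j, (iterLog m r)⁻¹
        + (3 / 4 + ε) * r ^ (α - 2) * ((iterLog 1 r)⁻¹) ^ 2 ≤ q r) :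
    NonoscillatoryAtZero R α
      (fun r : ℝ =>
        (((n : ℝ) - 1) * ((n : ℝ) - 3 + 2 * α) / 4 + (l : ℝ) * ((l : ℝ) + (n : ℝ) - 2)) *
            r ^ (α - 2) + q r) ∧
    LimitPointAtZero R α
      (fun r : ℝ =>
        (((n : ℝ) - 1) * ((n : ℝ) - 3 + 2 * α) / 4 + (l : ℝ) * ((l : ℝ) + (n : ℝ) - 2)) *
            r ^ (α - 2) + q r) := by
  obtain ⟨N, rfl⟩ : ∃ M, N = M + 1 := ⟨N - 1, by omega⟩
  refine limitPointAtZero_and_nonoscillatoryAtZero (N := N) hα (fun x hx y hy => ?_) hε hr₁ ?_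
  · have hsub : uIcc x y ⊆ Ioo 0 R := ordConnected_Ioo.uIcc_subset hx hy
    refine IntervalIntegrable.add (IntervalIntegrable.const_mul ?_ _)
      ((hq_loc.integrableOn_compact_subset hsub isCompact_uIcc).intervalIntegrable)
    refine ContinuousOn.intervalIntegrable fun t ht => ?_
    exact (Real.continuousAt_rpow_const _ _ (.inl (hsub ht).1.ne')).continuousWithinAt
  · filter_upwards [hq] with r hr hmem
    have h := hr hmem
    simp only [invLogSum, invLogProd]
    linarith
end
end

section
/- Let β ∈ ℝ, γ ∈ [0,∞), R ∈ (0,∞), and consider on (0,R) the differential expression τ_{β,γ} = −(d/dx) x^β (d/dx) + (1/4)[ (2−β)²γ² − (1−β)² ]·x^(β−2). Then τ_{β,γ} is nonoscillatory at x = 0; τ_{β,γ} is in the limit point case at x = 0 if β ≥ 2, or if β < 2 and γ ≥ 1; and τ_{β,γ} is in the limit circle case at x = 0 if β < 2 and γ ∈ [0,1). -/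
noncomputable section

open MeasureTheory Set
open scoped ENNReal NNReal

section Existence

variable {E : Type*} [NormedAddCommGroup E] [NormedSpace ℝ E]

/-- The terms of the Peano–Baker series of the linear equation `w' = A w`, `w 0 = w₀`. -/
def peanoBakerTerm (A : ℝ → E →L[ℝ] E) (w₀ : E) : ℕ → ℝ → E
  | 0 => fun _ => w₀
  | n + 1 => fun s => ∫ t in (0 : ℝ)..s, A t (peanoBakerTerm A w₀ n t)

lemma continuous_peanoBakerTerm [CompleteSpace E] {A : ℝ → E →L[ℝ] E} (hA : Continuous A)
    (w₀ : E) (n : ℕ) : Continuous (peanoBakerTerm A w₀ n) := by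
  induction n with
  | zero => exact continuous_const
  | succ n ih =>
    exact intervalIntegral.continuous_primitive
      (fun a b => (hA.clm_apply ih).intervalIntegrable a b) 0

lemma hasDerivAt_peanoBakerTerm_succ [CompleteSpace E] {A : ℝ → E →L[ℝ] E} (hA : Continuous A)
    (w₀ : E) (n : ℕ) (s : ℝ) :
    HasDerivAt (peanoBakerTerm A w₀ (n + 1)) (A s (peanoBakerTerm A w₀ n s)) s :=
  (hA.clm_apply (continuous_peanoBakerTerm hA w₀ n)).integral_hasStrictDerivAt 0 s |>.hasDerivAt

lemma norm_peanoBakerTerm_le [CompleteSpace E] {A : ℝ → E →L[ℝ] E} (hA : Continuous A) (w₀ : E)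
    {m T : ℝ} (hm : ∀ s, |s| ≤ T → ‖A s‖ ≤ m) (n : ℕ) :
    ∀ s, |s| ≤ T → ‖peanoBakerTerm A w₀ n s‖ ≤ ‖w₀‖ * (m ^ n * |s| ^ n / n.factorial) := by
  induction n with
  | zero => intro s _; simp [peanoBakerTerm]
  | succ n ih =>
    intro s hs
    have hm0 : 0 ≤ m := (norm_nonneg _).trans (hm s hs)
    have hcont : Continuous fun t => A t (peanoBakerTerm A w₀ n t) :=
      hA.clm_apply (continuous_peanoBakerTerm hA w₀ n)
    have hle : ∀ t ∈ uIoc 0 s, |t| ≤ |s| := by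
      intro t ht
      simpa using abs_sub_left_of_mem_uIcc (uIoc_subset_uIcc ht)
    calc ‖peanoBakerTerm A w₀ (n + 1) s‖
        ≤ ∫ t in uIoc 0 s, ‖A t (peanoBakerTerm A w₀ n t)‖ :=
          intervalIntegral.norm_integral_le_integral_norm_uIoc
      _ ≤ ∫ t in uIoc 0 s, ‖w₀‖ * (m ^ (n + 1) / n.factorial) * |t - 0| ^ n := by
          refine setIntegral_mono_on (hcont.norm.integrableOn_uIoc)
            (Continuous.integrableOn_uIoc (by fun_prop)) measurableSet_uIoc fun t ht => ?_
          have htT := (hle t ht).trans hs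
          calc ‖A t (peanoBakerTerm A w₀ n t)‖
              ≤ ‖A t‖ * ‖peanoBakerTerm A w₀ n t‖ := (A t).le_opNorm _
            _ ≤ m * (‖w₀‖ * (m ^ n * |t| ^ n / n.factorial)) := by
                gcongr
                · exact hm t htT
                · exact ih t htT
            _ = _ := by rw [sub_zero]; ring
      _ = ‖w₀‖ * (m ^ (n + 1) * |s| ^ (n + 1) / (n + 1).factorial) := by
          rw [integral_const_mul, integral_pow_abs_sub_uIoc, Nat.factorial_succ, sub_zero]
          push_cast
          field_simp

/-- A homogeneous linear differential equation with continuous coefficients on the real line has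
a global solution with prescribed value at `0`. -/
theorem exists_hasDerivAt_linear [CompleteSpace E] {A : ℝ → E →L[ℝ] E} (hA : Continuous A)
    (w₀ : E) : ∃ w : ℝ → E, w 0 = w₀ ∧ ∀ s, HasDerivAt w (A s (w s)) s := by
  have bound : ∀ T : ℝ, ∃ m, 0 ≤ m ∧ ∀ s, |s| ≤ T → ‖A s‖ ≤ m := by
    intro T
    obtain ⟨m, hm⟩ := (isCompact_Icc (a := -T) (b := T)).exists_bound_of_continuousOn
      hA.continuousOn
    exact ⟨max m 0, le_max_right _ _, fun s hs => (hm s (abs_le.1 hs)).trans (le_max_left _ _)⟩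
  have maj : ∀ T : ℝ, ∃ c : ℕ → ℝ, Summable c ∧
      ∀ n s, |s| ≤ T → ‖peanoBakerTerm A w₀ n s‖ ≤ c n := by
    intro T
    obtain ⟨m, hm0, hm⟩ := bound T
    refine ⟨fun n => ‖w₀‖ * ((m * T) ^ n / n.factorial),
      (Real.summable_pow_div_factorial (m * T)).mul_left _, fun n s hs => ?_⟩
    refine (norm_peanoBakerTerm_le hA w₀ hm n s hs).trans ?_
    beta_reduce
    rw [mul_pow]
    gcongr
  have summ : ∀ s, Summable fun n => peanoBakerTerm A w₀ n s := by
    intro s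
    obtain ⟨c, hc, hle⟩ := maj |s|
    exact hc.of_norm_bounded fun n => hle n s le_rfl
  refine ⟨fun s => ∑' n, peanoBakerTerm A w₀ n s, ?_, fun s => ?_⟩
  · beta_reduce
    rw [tsum_eq_single 0]
    · rfl
    · intro n hn
      obtain ⟨k, rfl⟩ := Nat.exists_eq_succ_of_ne_zero hn
      exact intervalIntegral.integral_same
  · obtain ⟨c, hc, hle⟩ := maj (|s| + 1)
    obtain ⟨m, hm0, hm⟩ := bound (|s| + 1)
    have key : HasDerivAt (fun y => ∑' n, peanoBakerTerm A w₀ (n + 1) y)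
        (∑' n, A s (peanoBakerTerm A w₀ n s)) s := by
      refine hasDerivAt_tsum_of_isPreconnected (hc.mul_left m) Metric.isOpen_ball
        (convex_ball (0 : ℝ) (|s| + 1)).isPreconnected
        (fun n y _ => hasDerivAt_peanoBakerTerm_succ hA w₀ n y) (fun n y hy => ?_)
        (y₀ := s) (by simp) ((summable_nat_add_iff 1).2 (summ s)) (by simp)
      have hy' : |y| ≤ |s| + 1 := by simpa using (mem_ball_zero_iff.1 hy).le
      exact ((A y).le_opNorm _).trans
        (mul_le_mul (hm y hy') (hle n y hy') (norm_nonneg _) hm0)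
    rw [ContinuousLinearMap.map_tsum _ (summ s)]
    have split : (fun y => ∑' n, peanoBakerTerm A w₀ n y) =
        fun y => w₀ + ∑' n, peanoBakerTerm A w₀ (n + 1) y := by
      ext y
      exact (summ y).tsum_eq_zero_add
    rw [split]
    exact key.const_add w₀

end Existence

/-- `(u, v)` solves `x ^ β u' = v`, `v' = (Q - z) u` pointwise on `I`. -/
def IsClassicalSolution (I : Set ℝ) (β : ℝ) (Q : ℝ → ℝ) (z : ℂ) (u v : ℝ → ℂ) : Prop :=
  ∀ x ∈ I, HasDerivAt u (((x ^ (-β) : ℝ) : ℂ) * v x) x ∧ HasDerivAt v (((Q x : ℂ) - z) * u x) x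

namespace IsClassicalSolution

variable {I J : Set ℝ} {β : ℝ} {Q : ℝ → ℝ} {z : ℂ} {u v : ℝ → ℂ}

lemma mono (h : IsClassicalSolution I β Q z u v) (hJ : J ⊆ I) : IsClassicalSolution J β Q z u v :=
  fun x hx => h x (hJ hx)

lemma continuousOn_fst (h : IsClassicalSolution I β Q z u v) : ContinuousOn u I :=
  fun x hx => (h x hx).1.continuousAt.continuousWithinAt

lemma continuousOn_snd (h : IsClassicalSolution I β Q z u v) : ContinuousOn v I :=
  fun x hx => (h x hx).2.continuousAt.continuousWithinAt

end IsClassicalSolution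

lemma uIcc_subset_Ioo {a b x y : ℝ} (hx : x ∈ Ioo a b) (hy : y ∈ Ioo a b) : uIcc x y ⊆ Ioo a b :=
  ordConnected_Ioo.uIcc_subset hx hy

lemma eq_add_integral_of_hasDerivAt {E : Type*} [NormedAddCommGroup E] [NormedSpace ℝ E]
    [CompleteSpace E] {f f' : ℝ → E} {a b : ℝ} (hf : ∀ x ∈ Ioo a b, HasDerivAt f (f' x) x)
    (hf' : ContinuousOn f' (Ioo a b)) {x y : ℝ} (hx : x ∈ Ioo a b) (hy : y ∈ Ioo a b) :
    f x = f y + ∫ t in y..x, f' t := by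
  have hsub := uIcc_subset_Ioo hy hx
  rw [intervalIntegral.integral_eq_sub_of_hasDerivAt (fun t ht => hf t (hsub ht))
    (hf'.mono hsub).intervalIntegrable]
  abel

lemma hasDerivAt_of_eq_add_integral {E : Type*} [NormedAddCommGroup E] [NormedSpace ℝ E]
    [CompleteSpace E] {f g : ℝ → E} {a b : ℝ}
    (hf : ∀ x ∈ Ioo a b, ∀ y ∈ Ioo a b, f x = f y + ∫ t in y..x, g t)
    (hg : ContinuousOn g (Ioo a b)) {x : ℝ} (hx : x ∈ Ioo a b) : HasDerivAt f (g x) x := by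
  have hmem := Ioo_mem_nhds hx.1 hx.2
  have h : HasDerivAt (fun y => f x + ∫ t in x..y, g t) (g x) x :=
    (intervalIntegral.integral_hasDerivAt_right IntervalIntegrable.refl
      (hg.stronglyMeasurableAtFilter isOpen_Ioo x hx) (hg.continuousAt hmem)).const_add _
  refine h.congr_of_eventuallyEq ?_
  filter_upwards [hmem] with y hy using hf y hy x hx

lemma continuousOn_of_eq_add_integral {E : Type*} [NormedAddCommGroup E] [NormedSpace ℝ E]
    {f g : ℝ → E} {a b : ℝ}
    (hf : ∀ x ∈ Ioo a b, ∀ y ∈ Ioo a b, f x = f y + ∫ t in y..x, g t)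
    (hg : ∀ x ∈ Ioo a b, ∀ y ∈ Ioo a b, IntervalIntegrable g volume x y) :
    ContinuousOn f (Ioo a b) := by
  intro x hx
  obtain ⟨c, hac, hcx⟩ := exists_between hx.1
  obtain ⟨d, hxd, hdb⟩ := exists_between hx.2
  have hc : c ∈ Ioo a b := ⟨hac, hcx.trans hx.2⟩
  have hd : d ∈ Ioo a b := ⟨hx.1.trans hxd, hdb⟩
  have hcd : c ≤ d := (hcx.trans hxd).le
  have hI : IntegrableOn g (uIcc c d) :=
    (intervalIntegrable_iff').1 (hg c hc d hd)
  have h := intervalIntegral.continuousOn_primitive_interval hI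
  rw [uIcc_of_le hcd] at h
  have h' : ContinuousAt (fun y => f c + ∫ t in c..y, g t) x :=
    continuousAt_const.add (h.continuousAt (Icc_mem_nhds hcx hxd))
  refine (h'.congr ?_).continuousWithinAt
  filter_upwards [Ioo_mem_nhds hx.1 hx.2] with y hy using (hf y hy c hc).symm

lemma continuousOn_ofReal_rpow (s : ℝ) :
    ContinuousOn (fun x : ℝ => ((x ^ s : ℝ) : ℂ)) (Ioi 0) :=
  Complex.continuous_ofReal.comp_continuousOn
    (continuousOn_id.rpow_const fun _ hx => Or.inl (ne_of_gt hx))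

lemma continuousOn_ofReal_sub {Q : ℝ → ℝ} {I : Set ℝ} (hQ : ContinuousOn Q I) (z : ℂ) :
    ContinuousOn (fun x : ℝ => (Q x : ℂ) - z) I :=
  (Complex.continuous_ofReal.comp_continuousOn hQ).sub continuousOn_const

lemma IsClassicalSolution.isSolutionC {R β : ℝ} {Q : ℝ → ℝ} {z : ℂ} {u v : ℝ → ℂ}
    (hQ : ContinuousOn Q (Ioo 0 R)) (h : IsClassicalSolution (Ioo 0 R) β Q z u v) :
    IsSolutionC R β Q z u v := fun _ hx _ hy =>
  ⟨eq_add_integral_of_hasDerivAt (fun t ht => (h t ht).1)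
    (((continuousOn_ofReal_rpow (-β)).mono Ioo_subset_Ioi_self).mul h.continuousOn_snd) hx hy,
  eq_add_integral_of_hasDerivAt (fun t ht => (h t ht).2)
    ((continuousOn_ofReal_sub hQ z).mul h.continuousOn_fst) hx hy⟩

/-- If the first integral equation involves a function that is not locally integrable, its integral
takes the default value and `u` is constant near `0`; otherwise the solution is classical. -/
lemma IsSolutionC.isClassicalSolution_or_eq_const {R β : ℝ} {Q : ℝ → ℝ} {z : ℂ} {u v : ℝ → ℂ}
    (hQ : ContinuousOn Q (Ioo 0 R)) (h : IsSolutionC R β Q z u v) :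
    IsClassicalSolution (Ioo 0 R) β Q z u v ∨
      ∃ c ∈ Ioo 0 R, ∃ k : ℂ, ∀ x ∈ Ioo 0 c, u x = k := by
  by_cases hint : ∀ x ∈ Ioo 0 R, ∀ y ∈ Ioo 0 R,
      IntervalIntegrable (fun t : ℝ => ((t ^ (-β) : ℝ) : ℂ) * v t) volume x y
  · left
    have hu : ContinuousOn u (Ioo 0 R) :=
      continuousOn_of_eq_add_integral (fun x hx y hy => (h x hx y hy).1) hint
    have hQu := (continuousOn_ofReal_sub hQ z).mul hu
    have hv' : ∀ x ∈ Ioo 0 R, HasDerivAt v (((Q x : ℂ) - z) * u x) x := fun _ hx =>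
      hasDerivAt_of_eq_add_integral (fun x hx y hy => (h x hx y hy).2) hQu hx
    have hv : ContinuousOn v (Ioo 0 R) :=
      fun x hx => (hv' x hx).continuousAt.continuousWithinAt
    exact fun x hx => ⟨hasDerivAt_of_eq_add_integral (fun x hx y hy => (h x hx y hy).1)
      (((continuousOn_ofReal_rpow (-β)).mono Ioo_subset_Ioi_self).mul hv) hx, hv' x hx⟩
  · right
    push Not at hint
    obtain ⟨a, ha, b, hb, hab⟩ := hint
    have hmin : min a b ∈ Ioo 0 R := ⟨lt_min ha.1 hb.1, (min_le_left _ _).trans_lt ha.2⟩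
    have hmax : max a b ∈ Ioo 0 R := ⟨lt_max_of_lt_left ha.1, max_lt ha.2 hb.2⟩
    refine ⟨min a b, hmin, u (max a b), fun x hx => ?_⟩
    rw [(h x ⟨hx.1, hx.2.trans hmin.2⟩ _ hmax).1, intervalIntegral.integral_undef, add_zero]
    refine fun hcon => hab (hcon.mono_set ?_)
    rw [uIcc_comm _ x, uIcc_of_le (hx.2.le.trans min_le_max)]
    exact Icc_subset_Icc_left hx.2.le

/-- Solutions with prescribed data at `1` exist on all of `(0, ∞)`. -/
lemma exists_isClassicalSolution {β : ℝ} {Q : ℝ → ℝ} (hQ : ContinuousOn Q (Ioi 0)) (z u₀ v₀ : ℂ) :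
    ∃ u v : ℝ → ℂ, u 1 = u₀ ∧ v 1 = v₀ ∧ IsClassicalSolution (Ioi 0) β Q z u v := by
  have hexp : ContinuousOn Real.exp univ := Real.continuous_exp.continuousOn
  have hmaps : MapsTo Real.exp univ (Ioi 0) := fun s _ => Real.exp_pos s
  have hp : Continuous fun s : ℝ => (Real.exp s : ℂ) * (((Real.exp s) ^ (-β) : ℝ) : ℂ) :=
    (Complex.continuous_ofReal.comp Real.continuous_exp).mul
      (continuousOn_univ.1 ((continuousOn_ofReal_rpow (-β)).comp hexp hmaps))
  have hq : Continuous fun s : ℝ => (Real.exp s : ℂ) * ((Q (Real.exp s) : ℂ) - z) :=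
    (Complex.continuous_ofReal.comp Real.continuous_exp).mul
      (continuousOn_univ.1 ((continuousOn_ofReal_sub hQ z).comp hexp hmaps))
  let A : ℝ → (ℂ × ℂ →L[ℝ] ℂ × ℂ) := fun s =>
    ((Real.exp s : ℂ) * (((Real.exp s) ^ (-β) : ℝ) : ℂ)) •
      ((ContinuousLinearMap.inl ℝ ℂ ℂ).comp (ContinuousLinearMap.snd ℝ ℂ ℂ)) +
    ((Real.exp s : ℂ) * ((Q (Real.exp s) : ℂ) - z)) •
      ((ContinuousLinearMap.inr ℝ ℂ ℂ).comp (ContinuousLinearMap.fst ℝ ℂ ℂ))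
  have hA : Continuous A := (hp.smul continuous_const).add (hq.smul continuous_const)
  obtain ⟨w, hw0, hw⟩ := exists_hasDerivAt_linear hA (u₀, v₀)
  refine ⟨fun x => (w (Real.log x)).1, fun x => (w (Real.log x)).2, by simp [hw0], by simp [hw0],
    fun x hx => ?_⟩
  have hx0 : (x : ℂ) ≠ 0 := by exact_mod_cast (ne_of_gt hx : x ≠ 0)
  have hd := (hw (Real.log x)).scomp x (Real.hasDerivAt_log (ne_of_gt hx))
  have h1 := (ContinuousLinearMap.fst ℝ ℂ ℂ).hasFDerivAt.comp_hasDerivAt x hd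
  have h2 := (ContinuousLinearMap.snd ℝ ℂ ℂ).hasFDerivAt.comp_hasDerivAt x hd
  constructor
  · refine h1.congr_deriv ?_
    simp [A, Real.exp_log hx, -Complex.ofReal_exp]
    field_simp
  · refine h2.congr_deriv ?_
    simp [A, Real.exp_log hx, -Complex.ofReal_exp]
    field_simp

lemma IsClassicalSolution.wronskian_eq {β : ℝ} {Q : ℝ → ℝ} {z : ℂ} {φ₁ ψ₁ φ₂ ψ₂ : ℝ → ℂ}
    (h₁ : IsClassicalSolution (Ioi 0) β Q z φ₁ ψ₁) (h₂ : IsClassicalSolution (Ioi 0) β Q z φ₂ ψ₂)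
    {x y : ℝ} (hx : 0 < x) (hy : 0 < y) :
    φ₁ x * ψ₂ x - φ₂ x * ψ₁ x = φ₁ y * ψ₂ y - φ₂ y * ψ₁ y := by
  have hd : ∀ t ∈ Ioi (0 : ℝ), HasDerivAt (fun t => φ₁ t * ψ₂ t - φ₂ t * ψ₁ t) 0 t := fun t ht =>
    (((h₁ t ht).1.mul (h₂ t ht).2).sub ((h₂ t ht).1.mul (h₁ t ht).2)).congr_deriv (by ring)
  exact isOpen_Ioi.is_const_of_deriv_eq_zero isPreconnected_Ioi
    (fun t ht => (hd t ht).differentiableAt.differentiableWithinAt) (fun t ht => (hd t ht).deriv)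
    hx hy

/-- A Gronwall-type bound, backwards in time, with an integrable rate. -/
lemma bddAbove_of_neg_mul_le_deriv {N N' K : ℝ → ℝ} {R c : ℝ} (hc : c ∈ Ioo 0 R)
    (hN : ∀ x ∈ Ioo 0 R, HasDerivAt N (N' x) x) (hK : ContinuousOn K (Ioo 0 R))
    (hK0 : ∀ x, 0 ≤ K x) (hKi : IntegrableOn K (Ioo 0 c)) (hN0 : ∀ x, 0 ≤ N x)
    (hle : ∀ x ∈ Ioo 0 R, -(K x * N x) ≤ N' x) :
    ∃ C, 0 ≤ C ∧ ∀ x ∈ Ioo 0 c, N x ≤ C := by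
  have hG : ∀ x ∈ Ioo 0 R, HasDerivAt (fun y => ∫ t in c..y, K t) (K x) x := fun x hx =>
    intervalIntegral.integral_hasDerivAt_right
      (hK.mono (uIcc_subset_Ioo hc hx)).intervalIntegrable
      (hK.stronglyMeasurableAtFilter isOpen_Ioo x hx) (hK.continuousAt (Ioo_mem_nhds hx.1 hx.2))
  have hd : ∀ x ∈ Ioo 0 R, HasDerivAt (fun y => N y * Real.exp (∫ t in c..y, K t))
      ((N' x + K x * N x) * Real.exp (∫ t in c..x, K t)) x := fun x hx =>
    ((hN x hx).mul (hG x hx).exp).congr_deriv (by ring)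
  have hmono : MonotoneOn (fun y => N y * Real.exp (∫ t in c..y, K t)) (Ioo 0 R) := by
    refine monotoneOn_of_deriv_nonneg (convex_Ioo 0 R)
      (fun x hx => (hd x hx).continuousAt.continuousWithinAt)
      (fun x hx => (hd x (interior_subset hx)).differentiableAt.differentiableWithinAt)
      fun x hx => ?_
    have hx' := interior_subset hx
    rw [(hd x hx').deriv]
    exact mul_nonneg (by linarith [hle x hx']) (Real.exp_pos _).le
  refine ⟨N c * Real.exp (∫ t in Ioo 0 c, K t), mul_nonneg (hN0 c) (Real.exp_pos _).le,
    fun x hx => ?_⟩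
  have h1 := hmono ⟨hx.1, hx.2.trans hc.2⟩ hc hx.2.le
  simp only [intervalIntegral.integral_same, Real.exp_zero, mul_one] at h1
  have h2 : -(∫ t in c..x, K t) ≤ ∫ t in Ioo 0 c, K t := by
    rw [← intervalIntegral.integral_symm, intervalIntegral.integral_of_le hx.2.le,
      integral_Ioc_eq_integral_Ioo]
    exact setIntegral_mono_set hKi (Filter.Eventually.of_forall hK0)
      (Ioo_subset_Ioo_left hx.1.le).eventuallyLE
  calc N x = N x * Real.exp (∫ t in c..x, K t) * Real.exp (-(∫ t in c..x, K t)) := by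
        rw [mul_assoc, ← Real.exp_add]; simp
    _ ≤ N c * Real.exp (∫ t in Ioo 0 c, K t) := by
        gcongr
        exact hN0 c

/-- If `τ φ = z₁ φ` has two linearly independent solutions that are square integrable near `0`,
then for every `z₂` all solutions of `τ u = z₂ u` are square integrable near `0`. -/
theorem IsClassicalSolution.integrableOn_norm_sq {R c β : ℝ} {Q : ℝ → ℝ} {z₁ z₂ w : ℂ}
    {φ₁ ψ₁ φ₂ ψ₂ u v : ℝ → ℂ} (hc : c ∈ Ioo 0 R)
    (h₁ : IsClassicalSolution (Ioo 0 R) β Q z₁ φ₁ ψ₁)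
    (h₂ : IsClassicalSolution (Ioo 0 R) β Q z₁ φ₂ ψ₂)
    (hw : w ≠ 0) (hW : ∀ x ∈ Ioo 0 R, φ₁ x * ψ₂ x - φ₂ x * ψ₁ x = w)
    (hi₁ : IntegrableOn (fun x => ‖φ₁ x‖ ^ 2) (Ioo 0 c))
    (hi₂ : IntegrableOn (fun x => ‖φ₂ x‖ ^ 2) (Ioo 0 c))
    (h : IsClassicalSolution (Ioo 0 R) β Q z₂ u v) :
    IntegrableOn (fun x => ‖u x‖ ^ 2) (Ioo 0 c) := by
  let A : ℝ → ℂ := fun x => (u x * ψ₂ x - v x * φ₂ x) / w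
  let B : ℝ → ℂ := fun x => (v x * φ₁ x - u x * ψ₁ x) / w
  let d : ℂ := (z₂ - z₁) / w
  have hA : ∀ x ∈ Ioo 0 R, HasDerivAt A (d * u x * φ₂ x) x := fun x hx =>
    ((((h x hx).1.mul (h₂ x hx).2).sub ((h x hx).2.mul (h₂ x hx).1)).div_const w).congr_deriv
      (by simp only [d]; ring)
  have hB : ∀ x ∈ Ioo 0 R, HasDerivAt B (-(d * u x * φ₁ x)) x := fun x hx =>
    ((((h x hx).2.mul (h₁ x hx).1).sub ((h x hx).1.mul (h₁ x hx).2)).div_const w).congr_deriv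
      (by simp only [d]; ring)
  have hu : ∀ x ∈ Ioo 0 R, u x = A x * φ₁ x + B x * φ₂ x := fun x hx => by
    simp only [A, B]
    field_simp
    rw [← hW x hx]
    ring
  have hnu : ∀ x ∈ Ioo 0 R, ‖u x‖ ≤ ‖A x‖ * ‖φ₁ x‖ + ‖B x‖ * ‖φ₂ x‖ := fun x hx => by
    rw [hu x hx]
    exact (norm_add_le _ _).trans_eq (by simp)
  let P : ℝ → ℝ := fun x => ‖φ₁ x‖ ^ 2 + ‖φ₂ x‖ ^ 2
  have hP : IntegrableOn P (Ioo 0 c) := hi₁.add hi₂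
  have hPc : ContinuousOn P (Ioo 0 R) :=
    (h₁.continuousOn_fst.norm.pow 2).add (h₂.continuousOn_fst.norm.pow 2)
  obtain ⟨C, hC0, hC⟩ : ∃ C, 0 ≤ C ∧ ∀ x ∈ Ioo 0 c, ‖A x‖ ^ 2 + ‖B x‖ ^ 2 ≤ C := by
    refine bddAbove_of_neg_mul_le_deriv (N := fun x => ‖A x‖ ^ 2 + ‖B x‖ ^ 2)
      (K := fun x => 2 * ‖d‖ * P x) hc
      (fun x hx => (hA x hx).norm_sq.add (hB x hx).norm_sq) (continuousOn_const.mul hPc)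
      (fun x => by positivity) (hP.const_mul _) (fun x => by positivity) fun x hx => ?_
    have e₁ := neg_le_of_abs_le (abs_real_inner_le_norm (A x) (d * u x * φ₂ x))
    have e₂ := neg_le_of_abs_le (abs_real_inner_le_norm (B x) (-(d * u x * φ₁ x)))
    rw [norm_neg] at e₂
    rw [norm_mul, norm_mul] at e₁ e₂
    have key : ‖u x‖ * (‖A x‖ * ‖φ₂ x‖ + ‖B x‖ * ‖φ₁ x‖) ≤ P x * (‖A x‖ ^ 2 + ‖B x‖ ^ 2) := by
      refine (mul_le_mul_of_nonneg_right (hnu x hx) (by positivity)).trans ?_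
      simp only [P]
      nlinarith [mul_nonneg (add_nonneg (sq_nonneg ‖A x‖) (sq_nonneg ‖B x‖))
          (sq_nonneg (‖φ₁ x‖ - ‖φ₂ x‖)),
        mul_nonneg (add_nonneg (sq_nonneg ‖φ₁ x‖) (sq_nonneg ‖φ₂ x‖))
          (sq_nonneg (‖A x‖ - ‖B x‖))]
    have key' := mul_le_mul_of_nonneg_left key (norm_nonneg d)
    linarith
  refine Integrable.mono' (hP.const_mul C) ?_ ?_
  · exact ((h.continuousOn_fst.mono (Ioo_subset_Ioo_right hc.2.le)).norm.pow 2).aestronglyMeasurable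
      measurableSet_Ioo
  · filter_upwards [ae_restrict_mem measurableSet_Ioo] with x hx
    have hxR : x ∈ Ioo 0 R := ⟨hx.1, hx.2.trans hc.2⟩
    rw [Real.norm_of_nonneg (by positivity)]
    calc ‖u x‖ ^ 2 ≤ (‖A x‖ * ‖φ₁ x‖ + ‖B x‖ * ‖φ₂ x‖) ^ 2 := by
          gcongr
          exact hnu x hxR
      _ ≤ (‖A x‖ ^ 2 + ‖B x‖ ^ 2) * P x := by
          simp only [P]
          nlinarith [sq_nonneg (‖A x‖ * ‖φ₂ x‖ - ‖B x‖ * ‖φ₁ x‖)]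
      _ ≤ C * P x := by
          gcongr
          exact hC x hx

lemma integrableOn_norm_sq_iff_lintegral {u : ℝ → ℂ} {c : ℝ} (hu : ContinuousOn u (Ioo 0 c)) :
    IntegrableOn (fun x => ‖u x‖ ^ 2) (Ioo 0 c) ↔
      (∫⁻ x in Ioo (0 : ℝ) c, (‖u x‖₊ : ℝ≥0∞) ^ 2) < ⊤ := by
  have hm : AEStronglyMeasurable (fun x => ‖u x‖ ^ 2) (volume.restrict (Ioo 0 c)) :=
    (hu.norm.pow 2).aestronglyMeasurable measurableSet_Ioo
  rw [IntegrableOn, Integrable, and_iff_right hm, hasFiniteIntegral_iff_enorm]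
  simp [enorm_eq_nnnorm]

section PowerPotential

variable {β s q : ℝ}

lemma hasDerivAt_rpow_solution (hs : s * (s - 1 + β) = q) {x : ℝ} (hx : 0 < x) :
    HasDerivAt (fun y : ℝ => y ^ s) (x ^ (-β) * (s * x ^ (s - 1 + β))) x ∧
      HasDerivAt (fun y : ℝ => s * y ^ (s - 1 + β)) (q * x ^ (β - 2) * x ^ s) x := by
  constructor
  · refine (Real.hasDerivAt_rpow_const (Or.inl hx.ne')).congr_deriv ?_
    rw [mul_left_comm, ← Real.rpow_add hx]
    ring_nf
  · refine ((Real.hasDerivAt_rpow_const (Or.inl hx.ne')).const_mul s).congr_deriv ?_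
    rw [← mul_assoc, hs, mul_assoc, ← Real.rpow_add hx]
    ring_nf

lemma hasDerivAt_rpow_mul_log_solution (hs : s * (s - 1 + β) = q) (hdouble : 2 * s - 1 + β = 0)
    {x : ℝ} (hx : 0 < x) :
    HasDerivAt (fun y : ℝ => y ^ s * Real.log y)
      (x ^ (-β) * (s * x ^ (s - 1 + β) * Real.log x + x ^ (s - 1 + β))) x ∧
      HasDerivAt (fun y : ℝ => s * y ^ (s - 1 + β) * Real.log y + y ^ (s - 1 + β))
        (q * x ^ (β - 2) * (x ^ s * Real.log x)) x := by
  obtain ⟨h₁, h₂⟩ := hasDerivAt_rpow_solution hs hx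
  have hlog := Real.hasDerivAt_log hx.ne'
  constructor
  · refine (h₁.mul hlog).congr_deriv ?_
    have e : x ^ s * x⁻¹ = x ^ (-β) * x ^ (s - 1 + β) := by
      rw [← Real.rpow_neg_one, ← Real.rpow_add hx, ← Real.rpow_add hx]
      ring_nf
    rw [e]
    ring
  · refine ((h₂.mul hlog).add (Real.hasDerivAt_rpow_const (Or.inl hx.ne'))).congr_deriv ?_
    have e : x ^ (s - 1 + β) * x⁻¹ = x ^ (s - 1 + β - 1) := by
      rw [← Real.rpow_neg_one, ← Real.rpow_add hx]
      ring_nf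
    rw [mul_assoc s, e]
    linear_combination x ^ (s - 1 + β - 1) * hdouble

lemma isSolutionR_rpow (R : ℝ) (hs : s * (s - 1 + β) = q) :
    IsSolutionR R β (fun x => q * x ^ (β - 2)) 0 (fun x => x ^ s)
      (fun x => s * x ^ (s - 1 + β)) := by
  have hc : ∀ r : ℝ, ContinuousOn (fun x : ℝ => x ^ r) (Ioo 0 R) := fun r =>
    continuousOn_id.rpow_const fun x hx => Or.inl (ne_of_gt hx.1)
  intro x hx y hy
  constructor
  · exact eq_add_integral_of_hasDerivAt (fun t ht => (hasDerivAt_rpow_solution hs ht.1).1)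
      ((hc _).mul (continuousOn_const.mul (hc _))) hx hy
  · simp only [sub_zero]
    exact eq_add_integral_of_hasDerivAt (fun t ht => (hasDerivAt_rpow_solution hs ht.1).2)
      ((continuousOn_const.mul (hc _)).mul (hc _)) hx hy

lemma isClassicalSolution_ofReal {I : Set ℝ} {Q u v : ℝ → ℝ}
    (h : ∀ x ∈ I, HasDerivAt u (x ^ (-β) * v x) x ∧ HasDerivAt v (Q x * u x) x) :
    IsClassicalSolution I β Q 0 (fun x => (u x : ℂ)) (fun x => (v x : ℂ)) := fun x hx =>
  ⟨(h x hx).1.ofReal_comp.congr_deriv (by push_cast; ring),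
    (h x hx).2.ofReal_comp.congr_deriv (by push_cast; ring)⟩

lemma isClassicalSolution_rpow (hs : s * (s - 1 + β) = q) :
    IsClassicalSolution (Ioi 0) β (fun x => q * x ^ (β - 2)) 0 (fun x => ((x ^ s : ℝ) : ℂ))
      (fun x => ((s * x ^ (s - 1 + β) : ℝ) : ℂ)) :=
  isClassicalSolution_ofReal fun _ hx => hasDerivAt_rpow_solution hs hx

lemma isClassicalSolution_rpow_mul_log (hs : s * (s - 1 + β) = q) (hdouble : 2 * s - 1 + β = 0) :
    IsClassicalSolution (Ioi 0) β (fun x => q * x ^ (β - 2)) 0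
      (fun x => ((x ^ s * Real.log x : ℝ) : ℂ))
      (fun x => ((s * x ^ (s - 1 + β) * Real.log x + x ^ (s - 1 + β) : ℝ) : ℂ)) :=
  isClassicalSolution_ofReal fun _ hx => hasDerivAt_rpow_mul_log_solution hs hdouble hx

lemma integrableOn_norm_ofReal_rpow_sq_iff {c : ℝ} (hc : 0 < c) :
    IntegrableOn (fun x : ℝ => ‖((x ^ s : ℝ) : ℂ)‖ ^ 2) (Ioo 0 c) ↔ -1 < 2 * s := by
  rw [← intervalIntegral.integrableOn_Ioo_rpow_iff hc]
  refine integrableOn_congr_fun (fun x hx => ?_) measurableSet_Ioo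
  rw [Complex.norm_real, Real.norm_eq_abs, sq_abs, ← Real.rpow_natCast, ← Real.rpow_mul hx.1.le]
  push_cast
  ring_nf

lemma integrableOn_norm_ofReal_rpow_mul_log_sq {c : ℝ} (hc : 0 < c) (hc1 : c ≤ 1)
    (hs : -1 < 2 * s) :
    IntegrableOn (fun x : ℝ => ‖((x ^ s * Real.log x : ℝ) : ℂ)‖ ^ 2) (Ioo 0 c) := by
  set ε : ℝ := (2 * s + 1) / 4 with hε
  have hε0 : 0 < ε := by rw [hε]; linarith
  have hmaj := ((integrableOn_norm_ofReal_rpow_sq_iff (s := s - ε) hc).2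
    (by rw [hε]; linarith)).const_mul ((1 / ε) ^ 2)
  refine Integrable.mono' hmaj ?_ ?_
  · refine ContinuousOn.aestronglyMeasurable ?_ measurableSet_Ioo
    refine (Complex.continuous_ofReal.comp_continuousOn (ContinuousOn.mul ?_ ?_)).norm.pow 2
    · exact continuousOn_id.rpow_const fun x hx => Or.inl (ne_of_gt hx.1)
    · exact Real.continuousOn_log.mono fun x hx => ne_of_gt hx.1
  · filter_upwards [ae_restrict_mem measurableSet_Ioo] with x hx
    have hlog := (Real.abs_log_mul_self_rpow_lt x ε hx.1 (hx.2.le.trans hc1) hε0).le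
    rw [Real.norm_of_nonneg (by positivity), ← mul_pow, Complex.norm_real, Complex.norm_real,
      Real.norm_eq_abs, Real.norm_eq_abs]
    have e : x ^ s * Real.log x = (Real.log x * x ^ ε) * x ^ (s - ε) := by
      rw [mul_assoc, ← Real.rpow_add hx.1]
      ring_nf
    rw [e, abs_mul]
    gcongr

lemma continuousOn_const_mul_rpow (r : ℝ) : ContinuousOn (fun x : ℝ => q * x ^ r) (Ioi 0) :=
  continuousOn_const.mul (continuousOn_id.rpow_const fun _ hx => Or.inl (ne_of_gt hx))

theorem nonoscillatoryAtZero_of_root {R : ℝ} (hR : 0 < R) (hs : s * (s - 1 + β) = q) :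
    NonoscillatoryAtZero R β (fun x => q * x ^ (β - 2)) := by
  have hmem : R / 2 ∈ Ioo 0 R := ⟨half_pos hR, half_lt_self hR⟩
  refine ⟨_, _, isSolutionR_rpow R hs,
    fun h => (Real.rpow_pos_of_pos hmem.1 s).ne' (h _ hmem).1, R / 2, hmem, ?_⟩
  refine finite_empty.subset fun x hx => (Real.rpow_pos_of_pos hx.1.1 s).ne' hx.2

theorem limitPointAtZero_of_root {R : ℝ} (hR : 0 < R) (hs : s * (s - 1 + β) = q)
    (hs1 : 2 * s ≤ -1) : LimitPointAtZero R β (fun x => q * x ^ (β - 2)) := by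
  intro z
  have hQ := continuousOn_const_mul_rpow (q := q) (β - 2)
  have hsub : Ioo 0 R ⊆ Ioi 0 := Ioo_subset_Ioi_self
  have hc : R / 2 ∈ Ioo 0 R := ⟨half_pos hR, half_lt_self hR⟩
  obtain ⟨φ₁, ψ₁, hφ₁, hψ₁, h₁⟩ := exists_isClassicalSolution (β := β) hQ z 1 0
  obtain ⟨φ₂, ψ₂, hφ₂, hψ₂, h₂⟩ := exists_isClassicalSolution (β := β) hQ z 0 1
  by_contra! hcon
  have hL2 : ∀ u v, IsClassicalSolution (Ioi 0) β (fun x => q * x ^ (β - 2)) z u v →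
      IntegrableOn (fun x => ‖u x‖ ^ 2) (Ioo 0 (R / 2)) := fun u v h =>
    (integrableOn_norm_sq_iff_lintegral (h.continuousOn_fst.mono Ioo_subset_Ioi_self)).2
      (lt_top_iff_ne_top.2 (hcon u v ((h.mono hsub).isSolutionC (hQ.mono hsub)) _ hc))
  have hrpow := IsClassicalSolution.integrableOn_norm_sq hc (h₁.mono hsub) (h₂.mono hsub)
    one_ne_zero (fun x hx => by simp [h₁.wronskian_eq h₂ hx.1 one_pos, hφ₁, hψ₁, hφ₂, hψ₂])
    (hL2 _ _ h₁) (hL2 _ _ h₂) ((isClassicalSolution_rpow hs).mono hsub)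
  rw [integrableOn_norm_ofReal_rpow_sq_iff hc.1] at hrpow
  linarith

/-- The limit circle case follows from two independent square integrable solutions for `z = 0`. -/
theorem limitCircleAtZero_of_integrableOn {R c : ℝ} {Q : ℝ → ℝ} (hc : c ∈ Ioo 0 R)
    (hQ : ContinuousOn Q (Ioi 0)) {φ₁ ψ₁ φ₂ ψ₂ : ℝ → ℂ}
    (h₁ : IsClassicalSolution (Ioi 0) β Q 0 φ₁ ψ₁) (h₂ : IsClassicalSolution (Ioi 0) β Q 0 φ₂ ψ₂)
    (hW : φ₁ 1 * ψ₂ 1 - φ₂ 1 * ψ₁ 1 ≠ 0)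
    (hi₁ : IntegrableOn (fun x => ‖φ₁ x‖ ^ 2) (Ioo 0 c))
    (hi₂ : IntegrableOn (fun x => ‖φ₂ x‖ ^ 2) (Ioo 0 c)) : LimitCircleAtZero R β Q := by
  intro z u v huv
  have hsub : Ioo 0 R ⊆ Ioi 0 := Ioo_subset_Ioi_self
  rcases huv.isClassicalSolution_or_eq_const (hQ.mono hsub) with h | ⟨a, ha, k, hk⟩
  · refine ⟨c, hc, (integrableOn_norm_sq_iff_lintegral
      (h.continuousOn_fst.mono (Ioo_subset_Ioo_right hc.2.le))).1 ?_⟩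
    exact IsClassicalSolution.integrableOn_norm_sq hc (h₁.mono hsub) (h₂.mono hsub) hW
      (fun x hx => h₁.wronskian_eq h₂ hx.1 one_pos) hi₁ hi₂ h
  · have hu : ContinuousOn u (Ioo 0 a) := continuousOn_const.congr hk
    refine ⟨a, ha, (integrableOn_norm_sq_iff_lintegral hu).1 ?_⟩
    refine (integrableOn_congr_fun (g := fun _ => ‖k‖ ^ 2) (fun x hx => ?_)
      measurableSet_Ioo).2 (integrableOn_const (by simp))
    simp [hk x hx]

theorem limitCircleAtZero_of_ne_roots {R s₁ s₂ : ℝ} (hR : 0 < R) (hs₁ : s₁ * (s₁ - 1 + β) = q)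
    (hs₂ : s₂ * (s₂ - 1 + β) = q) (hne : s₁ ≠ s₂) (h₁ : -1 < 2 * s₁) (h₂ : -1 < 2 * s₂) :
    LimitCircleAtZero R β (fun x => q * x ^ (β - 2)) := by
  have hc : R / 2 ∈ Ioo 0 R := ⟨half_pos hR, half_lt_self hR⟩
  refine limitCircleAtZero_of_integrableOn hc (continuousOn_const_mul_rpow _)
    (isClassicalSolution_rpow hs₁) (isClassicalSolution_rpow hs₂) ?_
    ((integrableOn_norm_ofReal_rpow_sq_iff hc.1).2 h₁)
    ((integrableOn_norm_ofReal_rpow_sq_iff hc.1).2 h₂)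
  simpa [sub_eq_zero] using hne.symm

theorem limitCircleAtZero_of_double_root {R : ℝ} (hR : 0 < R) (hs : s * (s - 1 + β) = q)
    (hdouble : 2 * s - 1 + β = 0) (hs1 : -1 < 2 * s) :
    LimitCircleAtZero R β (fun x => q * x ^ (β - 2)) := by
  have hc0 : 0 < min (R / 2) 1 := lt_min (half_pos hR) one_pos
  have hc : min (R / 2) 1 ∈ Ioo 0 R := ⟨hc0, (min_le_left _ _).trans_lt (half_lt_self hR)⟩
  refine limitCircleAtZero_of_integrableOn hc (continuousOn_const_mul_rpow _)
    (isClassicalSolution_rpow hs) (isClassicalSolution_rpow_mul_log hs hdouble) ?_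
    ((integrableOn_norm_ofReal_rpow_sq_iff hc0).2 hs1)
    (integrableOn_norm_ofReal_rpow_mul_log_sq hc0 (min_le_right _ _) hs1)
  simp

end PowerPotential

theorem statement13 (β γ : ℝ) (hγ : 0 ≤ γ) (R : ℝ) (hR : 0 < R) :
    NonoscillatoryAtZero R β
      (fun x : ℝ => (1 / 4) * ((2 - β) ^ 2 * γ ^ 2 - (1 - β) ^ 2) * x ^ (β - 2)) ∧
    ((2 ≤ β ∨ (β < 2 ∧ 1 ≤ γ)) →
      LimitPointAtZero R β
        (fun x : ℝ => (1 / 4) * ((2 - β) ^ 2 * γ ^ 2 - (1 - β) ^ 2) * x ^ (β - 2))) ∧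
    ((β < 2 ∧ γ < 1) →
      LimitCircleAtZero R β
        (fun x : ℝ => (1 / 4) * ((2 - β) ^ 2 * γ ^ 2 - (1 - β) ^ 2) * x ^ (β - 2))) := by
  have hplus : (1 - β + (2 - β) * γ) / 2 * ((1 - β + (2 - β) * γ) / 2 - 1 + β) =
      (1 / 4) * ((2 - β) ^ 2 * γ ^ 2 - (1 - β) ^ 2) := by ring
  have hminus : (1 - β - (2 - β) * γ) / 2 * ((1 - β - (2 - β) * γ) / 2 - 1 + β) =
      (1 / 4) * ((2 - β) ^ 2 * γ ^ 2 - (1 - β) ^ 2) := by ring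
  refine ⟨nonoscillatoryAtZero_of_root hR hplus, ?_, ?_⟩
  · rintro (hβ | ⟨hβ, hγ1⟩)
    · exact limitPointAtZero_of_root hR hplus (by nlinarith)
    · exact limitPointAtZero_of_root hR hminus (by nlinarith)
  · rintro ⟨hβ, hγ1⟩
    rcases hγ.eq_or_lt with rfl | hγ0
    · exact limitCircleAtZero_of_double_root hR hplus (by ring) (by linarith)
    · exact limitCircleAtZero_of_ne_roots hR hplus hminus (by nlinarith) (by nlinarith)
        (by nlinarith)
end
end
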